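/- arXiv:2107.14477 — 3 statements merged into one kernel-verified Lean document; each statement's English description precedes it below -/
import Mathlib

section
/- There exists a unique algebra homomorphism ζ: ℜ → 𝔥 such that ζ(A) = (t₀+t₁−1)(t₀+t₁+1)/4, ζ(B) = (t₀+t₂−1)(t₀+t₂+1)/4, ζ(C) = (t₀+t₃−1)(t₀+t₃+1)/4; moreover this homomorphism satisfies ζ(δ) = (t₀²+t₁²+t₂²+t₃²)/4 − t₀/2 − 3/4. -/
open FreeAlgebra

noncomputable section

variable (F : Type) [Field F]

/-! ## The universal Racah algebra -/

/-- `α = [A,D] + AC - BA` in the free algebra on `A,B,C,D`. -/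
def alphaFree : FreeAlgebra F (Fin 4) :=
  ι F 0 * ι F 3 - ι F 3 * ι F 0 + ι F 0 * ι F 2 - ι F 1 * ι F 0

/-- `β = [B,D] + BA - CB` in the free algebra on `A,B,C,D`. -/
def betaFree : FreeAlgebra F (Fin 4) :=
  ι F 1 * ι F 3 - ι F 3 * ι F 1 + ι F 1 * ι F 0 - ι F 2 * ι F 1

/-- `γ = [C,D] + CB - AC` in the free algebra on `A,B,C,D`. -/
def gammaFree : FreeAlgebra F (Fin 4) :=
  ι F 2 * ι F 3 - ι F 3 * ι F 2 + ι F 2 * ι F 1 - ι F 0 * ι F 2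

/-- The defining relations of the universal Racah algebra:
`[A,B] = [B,C] = [C,A] = 2D` and `α`, `β`, `γ` commute with the generators. -/
inductive RacahRel : FreeAlgebra F (Fin 4) → FreeAlgebra F (Fin 4) → Prop
  | AB : RacahRel (ι F 0 * ι F 1 - ι F 1 * ι F 0) (2 * ι F 3)
  | BC : RacahRel (ι F 1 * ι F 2 - ι F 2 * ι F 1) (2 * ι F 3)
  | CA : RacahRel (ι F 2 * ι F 0 - ι F 0 * ι F 2) (2 * ι F 3)
  | alphaC (i : Fin 4) : RacahRel (alphaFree F * ι F i) (ι F i * alphaFree F)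
  | betaC (i : Fin 4) : RacahRel (betaFree F * ι F i) (ι F i * betaFree F)
  | gammaC (i : Fin 4) : RacahRel (gammaFree F * ι F i) (ι F i * gammaFree F)

/-- The universal Racah algebra `ℜ`. -/
abbrev RacahAlg := RingQuot (RacahRel F)

def rA : RacahAlg F := RingQuot.mkAlgHom F (RacahRel F) (ι F 0)
def rB : RacahAlg F := RingQuot.mkAlgHom F (RacahRel F) (ι F 1)
def rC : RacahAlg F := RingQuot.mkAlgHom F (RacahRel F) (ι F 2)
def rD : RacahAlg F := RingQuot.mkAlgHom F (RacahRel F) (ι F 3)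
def rDelta : RacahAlg F := rA F + rB F + rC F
def rAlpha : RacahAlg F := RingQuot.mkAlgHom F (RacahRel F) (alphaFree F)
def rBeta : RacahAlg F := RingQuot.mkAlgHom F (RacahRel F) (betaFree F)
def rGamma : RacahAlg F := RingQuot.mkAlgHom F (RacahRel F) (gammaFree F)

/-! ## The universal additive DAHA of type `(C₁∨, C₁)` -/

/-- The defining relations: `t₀ + t₁ + t₂ + t₃ = -1` and each `tᵢ²` is central. -/
inductive DAHARel : FreeAlgebra F (Fin 4) → FreeAlgebra F (Fin 4) → Prop
  | sum : DAHARel (ι F 0 + ι F 1 + ι F 2 + ι F 3) (-1)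
  | central (i j : Fin 4) : DAHARel (ι F i * ι F i * ι F j) (ι F j * (ι F i * ι F i))

/-- The universal additive DAHA `𝔥` of type `(C₁∨, C₁)`. -/
abbrev DAHAAlg := RingQuot (DAHARel F)

/-- The generators `t₀, t₁, t₂, t₃` of `𝔥`. -/
def tGen (i : Fin 4) : DAHAAlg F := RingQuot.mkAlgHom F (DAHARel F) (ι F i)

/-! ## Scalar restriction along `algebraMap`, actions as `F`-linear operators -/

/-- The `F`-vector space structure on a module over an `F`-algebra `A`. -/
def resF (A : Type) [Ring A] [Algebra F A] (W : Type) [AddCommGroup W] [Module A W] :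
    Module F W := Module.compHom W (algebraMap F A)

theorem resF_tower (A : Type) [Ring A] [Algebra F A] (W : Type) [AddCommGroup W] [Module A W]
    [instF : Module F W] (h : instF = resF F A W) : IsScalarTower F A W := by
  have key : ∀ (a : F) (u : W), a • u = algebraMap F A a • u := by
    intro a u; rw [h]; rfl
  exact ⟨fun a x w => by rw [Algebra.smul_def, mul_smul, key a (x • w)]⟩

/-- The action of `x : A` on an `A`-module `W` as an `F`-linear operator. -/
def opOf {A : Type} [Ring A] [Algebra F A] (x : A) (W : Type) [AddCommGroup W] [Module F W]
    [Module A W] [IsScalarTower F A W] : Module.End F W where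
  toFun w := x • w
  map_add' u v := smul_add x u v
  map_smul' a w := by
    simp only [RingHom.id_apply]
    rw [← algebraMap_smul A a w, ← mul_smul, ← Algebra.commutes, mul_smul, algebraMap_smul]

/-- `x : A` acts diagonalizably on the `A`-module `W`. -/
def ActsDiagOn {A : Type} [Ring A] [Algebra F A] (x : A) (W : Type) [AddCommGroup W]
    [Module A W] : Prop :=
  letI := resF F A W
  haveI := resF_tower F A W rfl
  (⨆ μ : F, Module.End.eigenspace (opOf F x W) μ) = ⊤

/-- `x : A` acts on the `A`-module `W` in a multiplicity-free way: every eigenvalue of the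
action of `x` has algebraic multiplicity one. -/
def ActsMultFreeOn {A : Type} [Ring A] [Algebra F A] (x : A) (W : Type) [AddCommGroup W]
    [Module A W] : Prop :=
  letI := resF F A W
  haveI := resF_tower F A W rfl
  ∀ μ : F, Module.End.HasEigenvalue (opOf F x W) μ →
    Module.finrank F (Module.End.maxGenEigenspace (opOf F x W) μ) = 1

/-- `x : A` acts on the `A`-module `W` as scalar multiplication by `μ : F`. -/
def actsAsScalar {A : Type} [Ring A] [Algebra F A] (x : A) (μ : F) (W : Type)
    [AddCommGroup W] [Module A W] : Prop :=
  letI := resF F A W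
  ∀ u : W, x • u = μ • u

/-- The trace of the action of `x : A` on the `A`-module `W`. -/
def traceOf {A : Type} [Ring A] [Algebra F A] (x : A) (W : Type) [AddCommGroup W]
    [Module A W] : F :=
  letI := resF F A W
  haveI := resF_tower F A W rfl
  LinearMap.trace F W (opOf F x W)

/-! ## Tridiagonal matrices, Leonard pairs and Leonard triples -/

/-- A square matrix is tridiagonal if each nonzero entry lies on the diagonal, the
superdiagonal, or the subdiagonal. -/
def IsTridiag {n : ℕ} (M : Matrix (Fin n) (Fin n) F) : Prop :=
  ∀ i j : Fin n, M i j ≠ 0 → (i : ℕ) = (j : ℕ) ∨ (i : ℕ) = (j : ℕ) + 1 ∨ (j : ℕ) = (i : ℕ) + 1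

/-- A tridiagonal matrix is irreducible if every superdiagonal and subdiagonal entry
is nonzero. -/
def IsIrrTridiag {n : ℕ} (M : Matrix (Fin n) (Fin n) F) : Prop :=
  IsTridiag F M ∧ ∀ i j : Fin n, ((i : ℕ) = (j : ℕ) + 1 ∨ (j : ℕ) = (i : ℕ) + 1) → M i j ≠ 0

/-- `x, y : A` act on the `A`-module `W` as a Leonard pair. -/
def ActsAsLeonardPairOn {A : Type} [Ring A] [Algebra F A] (x y : A) (W : Type)
    [AddCommGroup W] [Module A W] : Prop :=
  letI := resF F A W
  haveI := resF_tower F A W rfl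
  (∃ (n : ℕ) (b : Module.Basis (Fin n) F W),
      (LinearMap.toMatrix b b (opOf F x W)).IsDiag ∧
      IsIrrTridiag F (LinearMap.toMatrix b b (opOf F y W))) ∧
  (∃ (n : ℕ) (b : Module.Basis (Fin n) F W),
      (LinearMap.toMatrix b b (opOf F y W)).IsDiag ∧
      IsIrrTridiag F (LinearMap.toMatrix b b (opOf F x W)))

/-- `x, y, z : A` act on the `A`-module `W` as a Leonard triple. -/
def ActsAsLeonardTripleOn {A : Type} [Ring A] [Algebra F A] (x y z : A) (W : Type)
    [AddCommGroup W] [Module A W] : Prop :=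
  letI := resF F A W
  haveI := resF_tower F A W rfl
  (∃ (n : ℕ) (b : Module.Basis (Fin n) F W),
      (LinearMap.toMatrix b b (opOf F x W)).IsDiag ∧
      IsIrrTridiag F (LinearMap.toMatrix b b (opOf F y W)) ∧
      IsIrrTridiag F (LinearMap.toMatrix b b (opOf F z W))) ∧
  (∃ (n : ℕ) (b : Module.Basis (Fin n) F W),
      (LinearMap.toMatrix b b (opOf F y W)).IsDiag ∧
      IsIrrTridiag F (LinearMap.toMatrix b b (opOf F z W)) ∧
      IsIrrTridiag F (LinearMap.toMatrix b b (opOf F x W))) ∧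
  (∃ (n : ℕ) (b : Module.Basis (Fin n) F W),
      (LinearMap.toMatrix b b (opOf F z W)).IsDiag ∧
      IsIrrTridiag F (LinearMap.toMatrix b b (opOf F x W)) ∧
      IsIrrTridiag F (LinearMap.toMatrix b b (opOf F y W)))

/-! ## The irreducible `ℜ`-modules `R_d(a,b,c)` -/

/-- `θᵢ = (x + d/2 - i)(x + d/2 - i + 1)`. -/
def thP (x : F) (d i : ℕ) : F := (x + (d : F) / 2 - (i : F)) * (x + (d : F) / 2 - (i : F) + 1)

/-- `φᵢ = i(i-d-1)(a+b+c+d/2-i+2)(a+b-c+d/2-i+1)`. -/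
def phP (a b c : F) (d i : ℕ) : F :=
  (i : F) * ((i : F) - (d : F) - 1) * (a + b + c + (d : F) / 2 - (i : F) + 2) *
    (a + b - c + (d : F) / 2 - (i : F) + 1)

/-- `W` is (a copy of) the `(d+1)`-dimensional `ℜ`-module `R_d(a,b,c)`:  there is a basis
with respect to which `A` is lower bidiagonal with diagonal `θᵢ` and subdiagonal entries `1`,
`B` is upper bidiagonal with diagonal `θᵢ*` and superdiagonal entries `φᵢ`, and `δ` acts as
the prescribed scalar. -/
def IsRdModule (a b c : F) (d : ℕ) (W : Type) [AddCommGroup W] [Module (RacahAlg F) W] :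
    Prop :=
  letI := resF F (RacahAlg F) W
  ∃ v : Module.Basis (Fin (d + 1)) F W,
    (∀ i : Fin (d + 1), rA F • (v i : W) = thP F a d i • v i +
      (if h : (i : ℕ) + 1 < d + 1 then v ⟨(i : ℕ) + 1, h⟩ else 0)) ∧
    (∀ i : Fin (d + 1), rB F • (v i : W) = thP F b d i • v i +
      (if (i : ℕ) = 0 then 0 else
        phP F a b c d i • v ⟨(i : ℕ) - 1, lt_of_le_of_lt (Nat.sub_le _ _) i.isLt⟩)) ∧
    actsAsScalar F (rDelta F)
      ((d : F) / 2 * ((d : F) / 2 + 1) + a * (a + 1) + b * (b + 1) + c * (c + 1)) W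

/-! ## The homomorphism `ζ : ℜ → 𝔥` -/

/-- `ζ : ℜ → 𝔥` sends `A, B, C` to the prescribed elements of `𝔥`. -/
def IsZeta (ζ : RacahAlg F →ₐ[F] DAHAAlg F) : Prop :=
  ζ (rA F) = (1 / 4 : F) • ((tGen F 0 + tGen F 1 - 1) * (tGen F 0 + tGen F 1 + 1)) ∧
  ζ (rB F) = (1 / 4 : F) • ((tGen F 0 + tGen F 2 - 1) * (tGen F 0 + tGen F 2 + 1)) ∧
  ζ (rC F) = (1 / 4 : F) • ((tGen F 0 + tGen F 3 - 1) * (tGen F 0 + tGen F 3 + 1))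

/-- A `𝔥`-module considered as an `ℜ`-module via `ζ : ℜ → 𝔥`. -/
def racahModOfDaha (ζ : RacahAlg F →ₐ[F] DAHAAlg F) (V : Type) [AddCommGroup V]
    [Module (DAHAAlg F) V] : Module (RacahAlg F) V :=
  Module.compHom V ζ.toRingHom

/-! ## Composition factors -/

/-- The `i`-th factor of a composition series of submodules. -/
abbrev csFactor {R V : Type} [Ring R] [AddCommGroup V] [Module R V]
    (s : CompositionSeries (Submodule R V)) (i : Fin s.length) : Type :=
  (↥(s i.succ)) ⧸ Submodule.comap (s i.succ).subtype (s i.castSucc)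

/-! ## The `𝔥`-modules `E_d(a,b,c)` and `O_d(a,b,c)` -/

def sigP (a b c : F) (d : ℕ) : F := a + b + c - ((d : F) + 1) / 2
def tauP (a b c : F) (d : ℕ) : F := a + b - c - ((d : F) + 1) / 2
def lamP (a b c : F) (d : ℕ) : F := a - b - c - ((d : F) + 1) / 2
def muP (a b c : F) (d : ℕ) : F := c - a - b - ((d : F) + 1) / 2
def nuP (a b c : F) (d : ℕ) : F := b - a - c - ((d : F) + 1) / 2

/-- `W` is (a copy of) the `(d+1)`-dimensional `𝔥`-module `E_d(a,b,c)` (`d` odd):  there is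
a basis `v₀, …, v_d` (extended by zero to a sequence `w`) on which `t₀, t₁, t₂, t₃` act by the
prescribed formulas. -/
def IsEdModule (a b c : F) (d : ℕ) (W : Type) [AddCommGroup W] [Module (DAHAAlg F) W] :
    Prop :=
  letI := resF F (DAHAAlg F) W
  ∃ (v : Module.Basis (Fin (d + 1)) F W) (w : ℕ → W),
    (∀ i : Fin (d + 1), w i = v i) ∧ (∀ n : ℕ, d < n → w n = 0) ∧
    (∀ i : ℕ, Even i → 2 ≤ i → i + 1 ≤ d →
      tGen F 0 • w i = ((i : F) * ((d : F) - (i : F) + 1)) • w (i - 1)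
        - (((d : F) - 2 * (i : F) + 1) / 2) • w i) ∧
    (∀ i : ℕ, Odd i → i + 2 ≤ d →
      tGen F 0 • w i = (((d : F) - 2 * (i : F) - 1) / 2) • w i + w (i + 1)) ∧
    (tGen F 0 • w 0 = -(((d : F) + 1) / 2) • w 0) ∧
    (tGen F 0 • w d = -(((d : F) + 1) / 2) • w d) ∧
    (∀ i : ℕ, Even i → 2 ≤ i → i + 1 ≤ d →
      tGen F 1 • w i = ((i : F) * ((i : F) - (d : F) - 1)) • w (i - 1) + a • w i + w (i + 1)) ∧
    (∀ i : ℕ, Odd i → i ≤ d → tGen F 1 • w i = -a • w i) ∧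
    (tGen F 1 • w 0 = a • w 0 + w 1) ∧
    (∀ i : ℕ, Even i → i + 1 ≤ d → tGen F 2 • w i = b • w i) ∧
    (∀ i : ℕ, Odd i → i + 2 ≤ d →
      tGen F 2 • w i = -((sigP F a b c d + (i : F)) * (tauP F a b c d + (i : F))) • w (i - 1)
        - b • w i - w (i + 1)) ∧
    (tGen F 2 • w d = -((sigP F a b c d + (d : F)) * (tauP F a b c d + (d : F))) • w (d - 1)
      - b • w d) ∧
    (∀ i : ℕ, Even i → i + 1 ≤ d →
      tGen F 3 • w i = -((sigP F a b c d + tauP F a b c d + 2 * (i : F) + 2) / 2) • w i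
        - w (i + 1)) ∧
    (∀ i : ℕ, Odd i → i ≤ d →
      tGen F 3 • w i = ((sigP F a b c d + (i : F)) * (tauP F a b c d + (i : F))) • w (i - 1)
        + ((sigP F a b c d + tauP F a b c d + 2 * (i : F)) / 2) • w i)

/-- On `E_d(a,b,c)` the elements `t₀², t₁², t₂², t₃²` act as scalar multiplication by
`(d+1)²/4, a², b², c²` respectively. -/
def EdSquares (a b c : F) (d : ℕ) (W : Type) [AddCommGroup W] [Module (DAHAAlg F) W] :
    Prop :=
  actsAsScalar F (tGen F 0 * tGen F 0) (((d : F) + 1) ^ 2 / 4) W ∧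
  actsAsScalar F (tGen F 1 * tGen F 1) (a ^ 2) W ∧
  actsAsScalar F (tGen F 2 * tGen F 2) (b ^ 2) W ∧
  actsAsScalar F (tGen F 3 * tGen F 3) (c ^ 2) W

/-- `W` is (a copy of) the `(d+1)`-dimensional `𝔥`-module `O_d(a,b,c)` (`d` even):  there is
a basis `v₀, …, v_d` (extended by zero to a sequence `w`) on which `t₀, t₁, t₂, t₃` act by the
prescribed formulas. -/
def IsOdModule (a b c : F) (d : ℕ) (W : Type) [AddCommGroup W] [Module (DAHAAlg F) W] :
    Prop :=
  letI := resF F (DAHAAlg F) W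
  ∃ (v : Module.Basis (Fin (d + 1)) F W) (w : ℕ → W),
    (∀ i : Fin (d + 1), w i = v i) ∧ (∀ n : ℕ, d < n → w n = 0) ∧
    (∀ i : ℕ, Even i → 2 ≤ i → i ≤ d →
      tGen F 0 • w i = -((i : F) * (sigP F a b c d + (i : F))) • w (i - 1)
        + ((sigP F a b c d + 2 * (i : F)) / 2) • w i) ∧
    (∀ i : ℕ, Odd i → i + 1 ≤ d →
      tGen F 0 • w i = -((sigP F a b c d + 2 * (i : F) + 2) / 2) • w i + w (i + 1)) ∧
    (tGen F 0 • w 0 = (sigP F a b c d / 2) • w 0) ∧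
    (∀ i : ℕ, Even i → 2 ≤ i → i + 2 ≤ d →
      tGen F 1 • w i = ((i : F) * (sigP F a b c d + (i : F))) • w (i - 1)
        + (lamP F a b c d / 2) • w i + w (i + 1)) ∧
    (∀ i : ℕ, Odd i → i + 1 ≤ d → tGen F 1 • w i = -(lamP F a b c d / 2) • w i) ∧
    (tGen F 1 • w 0 = (lamP F a b c d / 2) • w 0 + w 1) ∧
    (tGen F 1 • w d = ((d : F) * (sigP F a b c d + (d : F))) • w (d - 1)
      + (lamP F a b c d / 2) • w d) ∧
    (∀ i : ℕ, Even i → i ≤ d → tGen F 2 • w i = (nuP F a b c d / 2) • w i) ∧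
    (∀ i : ℕ, Odd i → i + 1 ≤ d →
      tGen F 2 • w i = (((d : F) - (i : F) - 1) * (tauP F a b c d + (i : F))) • w (i - 1)
        - (nuP F a b c d / 2) • w i - w (i + 1)) ∧
    (∀ i : ℕ, Even i → i + 2 ≤ d →
      tGen F 3 • w i = ((2 * (d : F) + muP F a b c d - 2 * (i : F)) / 2) • w i - w (i + 1)) ∧
    (∀ i : ℕ, Odd i → i + 1 ≤ d →
      tGen F 3 • w i = (((i : F) - (d : F) - 1) * (tauP F a b c d + (i : F))) • w (i - 1)
        - ((2 * (d : F) + muP F a b c d - 2 * (i : F) + 2) / 2) • w i) ∧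
    (tGen F 3 • w d = (muP F a b c d / 2) • w d)

/-- On `O_d(a,b,c)` the elements `t₀², t₁², t₂², t₃²` act as the prescribed scalars. -/
def OdSquares (a b c : F) (d : ℕ) (W : Type) [AddCommGroup W] [Module (DAHAAlg F) W] :
    Prop :=
  actsAsScalar F (tGen F 0 * tGen F 0) (((a + b + c) / 2 - ((d : F) + 1) / 4) ^ 2) W ∧
  actsAsScalar F (tGen F 1 * tGen F 1) (((a - b - c) / 2 - ((d : F) + 1) / 4) ^ 2) W ∧
  actsAsScalar F (tGen F 2 * tGen F 2) (((c - a - b) / 2 - ((d : F) + 1) / 4) ^ 2) W ∧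
  actsAsScalar F (tGen F 3 * tGen F 3) (((b - a - c) / 2 - ((d : F) + 1) / 4) ^ 2) W

/-! ## The `{±1}²`-action on `𝔥` and twisted modules -/

theorem dahaSum : tGen F 0 + tGen F 1 + tGen F 2 + tGen F 3 = -1 := by
  have h := RingQuot.mkAlgHom_rel F (DAHARel.sum (F := F))
  simpa [tGen] using h

theorem dahaSqCentral (i j : Fin 4) :
    tGen F i * tGen F i * tGen F j = tGen F j * (tGen F i * tGen F i) := by
  have h := RingQuot.mkAlgHom_rel F (DAHARel.central (F := F) i j)
  simpa [tGen] using h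

/-- The algebra endomorphism of `𝔥` permuting the generators `t₀, t₁, t₂, t₃` by `π`. -/
def dahaAut (π : Equiv.Perm (Fin 4)) : DAHAAlg F →ₐ[F] DAHAAlg F :=
  RingQuot.liftAlgHom F ⟨FreeAlgebra.lift F (fun i => tGen F (π i)), by
    intro x y h
    cases h with
    | sum =>
        simp only [map_add, map_neg, map_one, FreeAlgebra.lift_ι_apply]
        have h4 : tGen F (π 0) + tGen F (π 1) + tGen F (π 2) + tGen F (π 3)
            = ∑ k : Fin 4, tGen F (π k) := by rw [Fin.sum_univ_four]
        rw [h4, Equiv.sum_comp π (tGen F), Fin.sum_univ_four, dahaSum]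
    | central i j =>
        simp only [map_mul, FreeAlgebra.lift_ι_apply]
        exact dahaSqCentral F (π i) (π j)⟩

/-- The element of the Klein group `{±1}²` acting on `𝔥` as the permutation of
`(t₀, t₁, t₂, t₃)` from Table 1. -/
def permOf (ε : ℤˣ × ℤˣ) : Equiv.Perm (Fin 4) :=
  if ε = (1, 1) then 1
  else if ε = (1, -1) then Equiv.swap 0 1 * Equiv.swap 2 3
  else if ε = (-1, 1) then Equiv.swap 0 2 * Equiv.swap 1 3
  else Equiv.swap 0 3 * Equiv.swap 1 2

/-- The `𝔥`-module `W^ε`: the underlying space of `W` with the action twisted by the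
automorphism of `𝔥` given by the permutation `π` of the generators. -/
def twMod (π : Equiv.Perm (Fin 4)) (W : Type) [AddCommGroup W] [Module (DAHAAlg F) W] :
    Module (DAHAAlg F) W :=
  Module.compHom W (dahaAut F π).toRingHom

/-- The trace of `x` on the twisted module `W^π`. -/
def twTrace (π : Equiv.Perm (Fin 4)) (x : DAHAAlg F) (W : Type) [AddCommGroup W]
    [Module (DAHAAlg F) W] : F :=
  @traceOf F _ (DAHAAlg F) _ _ x W _ (twMod F π W)

/-- `x` acts on the twisted module `W^π` as scalar multiplication by `μ`. -/
def twActsAsScalar (π : Equiv.Perm (Fin 4)) (x : DAHAAlg F) (μ : F) (W : Type)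
    [AddCommGroup W] [Module (DAHAAlg F) W] : Prop :=
  @actsAsScalar F _ (DAHAAlg F) _ _ x μ W _ (twMod F π W)

/-- The twisted module `W^π` is (a copy of) `E_d(a,b,c)`. -/
def twIsEdModule (π : Equiv.Perm (Fin 4)) (a b c : F) (d : ℕ) (W : Type) [AddCommGroup W]
    [Module (DAHAAlg F) W] : Prop :=
  @IsEdModule F _ a b c d W _ (twMod F π W)

end

theorem commute_shifted_sq {H : Type*} [Ring H] {s p : H} (hs : s * s ∈ Subring.center H)
    (hp : p * p ∈ Subring.center H) : Commute s ((s + p - 1) * (s + p + 1)) := by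
  have h := (Subring.mem_center_iff.1 hp s)
  have h' := (Subring.mem_center_iff.1 hs p)
  rw [commute_iff_eq]
  linear_combination (norm := noncomm_ring) h - h'

set_option maxHeartbeats 1000000 in
/-- The relation `[A, D] + A C - B A ∈ R[t₀, t₀², t₁², t₂², t₃²]` with denominators cleared. -/
theorem shifted_sq_relation_of_smul {R H : Type*} [CommRing R] [Ring H] [Algebra R H]
    {s p q : H} {c0 c1 c2 c3 : R} (hss : s * s = c0 • 1) (hpp : p * p = c1 • 1)
    (hqq : q * q = c2 • 1) (hrr : (-1 - s - p - q) * (-1 - s - p - q) = c3 • 1) {x y z : H}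
    (hx : x = (s + p - 1) * (s + p + 1)) (hy : y = (s + q - 1) * (s + q + 1))
    (hz : z = (s + (-1 - s - p - q) - 1) * (s + (-1 - s - p - q) + 1)) :
    x * (x * y - y * x) - (x * y - y * x) * x + 8 • (x * z - y * x)
      = 8 • ((q * q - (-1 - s - p - q) * (-1 - s - p - q)) * (s * s - p * p + 1 - 2 • s)) := by
  obtain ⟨u, hu⟩ : ∃ u, u = s * p + p * s := ⟨_, rfl⟩
  obtain ⟨v, hv⟩ : ∃ v, v = s * q + q * s := ⟨_, rfl⟩
  have hxu : x = u + (c0 + c1 - 1) • 1 := by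
    rw [hx, hu]
    linear_combination (norm := skip) hss + hpp
    noncomm_ring
    module
  have hyv : y = v + (c0 + c2 - 1) • 1 := by
    rw [hy, hv]
    linear_combination (norm := skip) hss + hqq
    noncomm_ring
    module
  have hzuv : z = (c3 - c0 - 1) • 1 - 2 • s - u - v := by
    rw [hz, hu, hv]
    linear_combination (norm := skip) hrr - hss
    noncomm_ring
    module
  have hps : p * s = u - s * p := by rw [hu]; abel
  have hqs : q * s = v - s * q := by rw [hv]; abel
  have hqp : q * p = (c3 - c0 - c1 - c2 - 1) • 1 - u - v - 2 • s - 2 • p - 2 • q - p * q := by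
    rw [hu, hv]
    linear_combination (norm := skip) hrr - hss - hpp - hqq
    noncomm_ring
    module
  have assoc {x y z : H} (h : x * y = z) (t : H) : x * (y * t) = z * t := by
    rw [← mul_assoc, h]
  have comm_anticomm {x : H} {c : R} (y : H) (hx : x * x = c • 1) :
      x * (x * y + y * x) = (x * y + y * x) * x := by
    simp only [mul_add, add_mul, mul_assoc, hx, smul_mul_assoc, mul_smul_comm, mul_one, one_mul,
      ← mul_assoc x x, add_comm]
  have hsu : s * u = u * s := by rw [hu, comm_anticomm p hss]
  have hpu : p * u = u * p := by rw [hu, add_comm, comm_anticomm s hpp]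
  have hsv : s * v = v * s := by rw [hv, comm_anticomm q hss]
  have hqv : q * v = v * q := by rw [hv, add_comm, comm_anticomm s hqq]
  have hwq := comm_anticomm p hqq
  have hwp := comm_anticomm q hpp
  rw [add_comm (p * q)] at hwp
  rw [hqp] at hwp hwq
  have hqu : q * u = u * q + 2 • (s * q - q * s + p * q - q * p) := by
    simp only [mul_add, add_mul, mul_sub, sub_mul, hqv, smul_mul_assoc, mul_smul_comm, one_mul,
      mul_one, mul_assoc] at hwq
    linear_combination (norm := module) -hwq
  have hpv : p * v = v * p + 2 • (s * p - p * s + q * p - p * q) := by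
    simp only [mul_add, add_mul, mul_sub, sub_mul, hpu, smul_mul_assoc, mul_smul_comm, one_mul,
      mul_one, mul_assoc] at hwp
    linear_combination (norm := module) -hwp
  rw [hqs, hqp] at hqu
  rw [hps, hqp] at hpv
  have hvu : v * u = u * v + 2 • (s * (p * q - q * p) + (p * q - q * p) * s) := by
    conv_lhs => rw [hv, add_mul, mul_assoc, mul_assoc, hsu, ← mul_assoc q, hqu]
    simp only [mul_add, add_mul, mul_sub, sub_mul, smul_mul_assoc, mul_smul_comm, mul_assoc,
      one_mul, mul_one, smul_add, smul_sub, hss, hps, hqs, hqp, hsv, assoc hss, assoc hps,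
      assoc hsu]
    module
  rw [hqp] at hvu
  rw [hxu, hyv, hzuv, hss, hpp, hqq, hrr]
  simp only [mul_add, add_mul, mul_sub, sub_mul, smul_mul_assoc, mul_smul_comm, mul_assoc,
    one_mul, mul_one, smul_add, smul_sub,
    hss, hpp, hps, hqs, hqp, hsu, hpu, hsv, hqu, hpv, hvu,
    assoc hss, assoc hpp, assoc hps, assoc hsu, assoc hpu, assoc hsv, assoc hvu]
  module

theorem shifted_sq_relation {H : Type*} [Ring H] {s p q r : H} (hs : s * s ∈ Subring.center H)
    (hp : p * p ∈ Subring.center H) (hq : q * q ∈ Subring.center H)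
    (hr : r * r ∈ Subring.center H) (hsum : s + p + q + r = -1) {x y z : H}
    (hx : x = (s + p - 1) * (s + p + 1)) (hy : y = (s + q - 1) * (s + q + 1))
    (hz : z = (s + r - 1) * (s + r + 1)) :
    x * (x * y - y * x) - (x * y - y * x) * x + 8 • (x * z - y * x)
      = 8 • ((q * q - r * r) * (s * s - p * p + 1 - 2 • s)) := by
  obtain rfl : r = -1 - s - p - q := by linear_combination (norm := abel) hsum
  have smul_one {x : H} (hx : x ∈ Subring.center H) :
      x = (⟨x, hx⟩ : Subring.center H) • (1 : H) := (mul_one x).symm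
  exact shifted_sq_relation_of_smul (smul_one hs) (smul_one hp) (smul_one hq) (smul_one hr) hx hy hz

section

variable {F H : Type*} [Field F] [CharZero F] [Ring H] [Algebra F H] {s p q r a b c : H}

theorem racah_relation (hs : s * s ∈ Subring.center H)
    (hp : p * p ∈ Subring.center H) (hq : q * q ∈ Subring.center H)
    (hr : r * r ∈ Subring.center H) (hsum : s + p + q + r = -1)
    (ha : a = (1 / 4 : F) • ((s + p - 1) * (s + p + 1)))
    (hb : b = (1 / 4 : F) • ((s + q - 1) * (s + q + 1)))
    (hc : c = (1 / 4 : F) • ((s + r - 1) * (s + r + 1))) :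
    a * ((1 / 2 : F) • (a * b - b * a)) - (1 / 2 : F) • (a * b - b * a) * a + a * c - b * a
      = (1 / 16 : F) • ((q * q - r * r) * (s * s - p * p + 1 - 2 • s)) := by
  have key := shifted_sq_relation hs hp hq hr hsum rfl rfl rfl
  generalize (s + p - 1) * (s + p + 1) = x at *
  generalize (s + q - 1) * (s + q + 1) = y at *
  generalize (s + r - 1) * (s + r + 1) = z at *
  subst ha hb hc
  simp only [smul_mul_assoc, mul_smul_comm, ← smul_sub, smul_smul]
  linear_combination (norm := module) (1 / 128 : F) • key

theorem commute_racah_relation (hs : s * s ∈ Subring.center H)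
    (hp : p * p ∈ Subring.center H) (hq : q * q ∈ Subring.center H)
    (hr : r * r ∈ Subring.center H) (hsum : s + p + q + r = -1)
    (ha : a = (1 / 4 : F) • ((s + p - 1) * (s + p + 1)))
    (hb : b = (1 / 4 : F) • ((s + q - 1) * (s + q + 1)))
    (hc : c = (1 / 4 : F) • ((s + r - 1) * (s + r + 1))) {e : H} (he : Commute s e) :
    Commute (a * ((1 / 2 : F) • (a * b - b * a)) - (1 / 2 : F) • (a * b - b * a) * a
      + a * c - b * a) e := by
  have central {x : H} (hx : x ∈ Subring.center H) : Commute x e :=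
    (Subring.mem_center_iff.1 hx e).symm
  rw [racah_relation hs hp hq hr hsum ha hb hc]
  exact (((central hq).sub_left (central hr)).mul_left
    ((((central hs).sub_left (central hp)).add_left (Commute.one_left e)).sub_left
      (he.smul_left 2))).smul_left _

theorem shifted_sq_sum (hsum : s + p + q + r = -1) :
    (1 / 4 : F) • ((s + p - 1) * (s + p + 1)) + (1 / 4 : F) • ((s + q - 1) * (s + q + 1))
        + (1 / 4 : F) • ((s + r - 1) * (s + r + 1))
      = (1 / 4 : F) • (s * s + p * p + q * q + r * r) - (1 / 2 : F) • s
        - algebraMap F H (3 / 4) := by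
  obtain rfl : r = -1 - s - p - q := by linear_combination (norm := abel) hsum
  rw [Algebra.algebraMap_eq_smul_one]
  simp only [mul_add, add_mul, mul_sub, sub_mul, mul_one, one_mul, mul_neg, neg_mul]
  module

end

section

variable (F : Type) [Field F]

theorem tGen_sq_mem_center (i : Fin 4) :
    tGen F i * tGen F i ∈ Subring.center (DAHAAlg F) := by
  rw [Subring.mem_center_iff]
  intro g
  obtain ⟨g, rfl⟩ := RingQuot.mkAlgHom_surjective F (DAHARel F) g
  induction g using FreeAlgebra.induction with
  | grade0 x => simp only [AlgHom.commutes]; exact Algebra.commutes _ _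
  | grade1 j => exact (dahaSqCentral F i j).symm
  | mul x y hx hy => rw [map_mul, mul_assoc, hy, ← mul_assoc, hx, mul_assoc]
  | add x y hx hy => rw [map_add, add_mul, mul_add, hx, hy]

theorem rD_eq [CharZero F] : rD F = (1 / 2 : F) • (rA F * rB F - rB F * rA F) := by
  have h := RingQuot.mkAlgHom_rel F (RacahRel.AB (F := F))
  simp only [map_sub, map_mul, map_ofNat] at h
  change rA F * rB F - rB F * rA F = 2 * rD F at h
  rw [h, two_mul]
  module

theorem racahHom_ext [CharZero F] {H : Type} [Ring H] [Algebra F H] {f g : RacahAlg F →ₐ[F] H}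
    (hA : f (rA F) = g (rA F)) (hB : f (rB F) = g (rB F)) (hC : f (rC F) = g (rC F)) :
    f = g := by
  apply RingQuot.ringQuot_ext'
  apply FreeAlgebra.hom_ext
  funext i
  fin_cases i
  · exact hA
  · exact hB
  · exact hC
  · change f (rD F) = g (rD F)
    simp only [rD_eq, map_smul, map_sub, map_mul, hA, hB]

theorem exists_isZeta [CharZero F] : ∃ ζ : RacahAlg F →ₐ[F] DAHAAlg F, IsZeta F ζ := by
  let x (i : Fin 4) : DAHAAlg F :=
    (1 / 4 : F) • ((tGen F 0 + tGen F i - 1) * (tGen F 0 + tGen F i + 1))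
  have hs := tGen_sq_mem_center F
  have hsum := dahaSum F
  have hx (i : Fin 4) : Commute (tGen F 0) (x i) :=
    (commute_shifted_sq (hs 0) (hs i)).smul_right _
  have hdelta (i : Fin 4) : Commute (x 1 + x 2 + x 3) (x i) := by
    have central (j : Fin 4) : Commute (tGen F j * tGen F j) (x i) :=
      (Subring.mem_center_iff.1 (hs j) (x i)).symm
    have h : x 1 + x 2 + x 3 = _ := shifted_sq_sum (F := F) hsum
    rw [h]
    exact ((((((central 0).add_left (central 1)).add_left (central 2)).add_left
      (central 3)).smul_left _).sub_left ((hx i).smul_left _)).sub_left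
      (Algebra.commute_algebraMap_left _ _)
  have hBC : x 2 * x 3 - x 3 * x 2 = x 1 * x 2 - x 2 * x 1 := by
    linear_combination (norm := noncomm_ring) -(hdelta 2).eq
  have hCA : x 3 * x 1 - x 1 * x 3 = x 1 * x 2 - x 2 * x 1 := by
    linear_combination (norm := noncomm_ring) (hdelta 1).eq
  have half_two (y : DAHAAlg F) : 2 * ((1 / 2 : F) • y) = y := by
    rw [two_mul]; module
  let g : Fin 4 → DAHAAlg F := ![x 1, x 2, x 3, (1 / 2 : F) • (x 1 * x 2 - x 2 * x 1)]
  have hg (i : Fin 4) : Commute (tGen F 0) (g i) := by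
    fin_cases i
    · exact hx 1
    · exact hx 2
    · exact hx 3
    · exact (((hx 1).mul_right (hx 2)).sub_right ((hx 2).mul_right (hx 1))).smul_right _
  have hrel ⦃y z : FreeAlgebra F (Fin 4)⦄ (h : RacahRel F y z) :
      FreeAlgebra.lift F g y = FreeAlgebra.lift F g z := by
    have g0 : g 0 = x 1 := rfl
    have g1 : g 1 = x 2 := rfl
    have g2 : g 2 = x 3 := rfl
    have g3 : g 3 = (1 / 2 : F) • (x 1 * x 2 - x 2 * x 1) := rfl
    cases h with
    | AB => simp only [map_sub, map_mul, map_ofNat, FreeAlgebra.lift_ι_apply, g0, g1, g3, half_two]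
    | BC =>
      simp only [map_sub, map_mul, map_ofNat, FreeAlgebra.lift_ι_apply, g1, g2, g3, half_two, hBC]
    | CA =>
      simp only [map_sub, map_mul, map_ofNat, FreeAlgebra.lift_ι_apply, g0, g2, g3, half_two, hCA]
    | alphaC i =>
      have := commute_racah_relation (F := F) (hs 0) (hs 1) (hs 2) (hs 3) hsum rfl rfl rfl (hg i)
      simpa only [alphaFree, map_sub, map_add, map_mul, FreeAlgebra.lift_ι_apply, g0, g1, g2, g3]
        using this.eq
    | betaC i =>
      have := commute_racah_relation (F := F) (a := x 2) (b := x 3) (c := x 1)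
        (hs 0) (hs 2) (hs 3) (hs 1)
        (by rw [← hsum]; abel) rfl rfl rfl (hg i)
      rw [hBC] at this
      simpa only [betaFree, map_sub, map_add, map_mul, FreeAlgebra.lift_ι_apply, g0, g1, g2, g3]
        using this.eq
    | gammaC i =>
      have := commute_racah_relation (F := F) (a := x 3) (b := x 1) (c := x 2)
        (hs 0) (hs 3) (hs 1) (hs 2)
        (by rw [← hsum]; abel) rfl rfl rfl (hg i)
      rw [hCA] at this
      simpa only [gammaFree, map_sub, map_add, map_mul, FreeAlgebra.lift_ι_apply, g0, g1, g2, g3]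
        using this.eq
  have hι (i : Fin 4) : RingQuot.liftAlgHom F ⟨FreeAlgebra.lift F g, hrel⟩
      (RingQuot.mkAlgHom F (RacahRel F) (ι F i)) = g i := by
    rw [RingQuot.liftAlgHom_mkAlgHom_apply, FreeAlgebra.lift_ι_apply]
  exact ⟨RingQuot.liftAlgHom F ⟨FreeAlgebra.lift F g, hrel⟩, hι 0, hι 1, hι 2⟩

end

/-- There is a unique algebra homomorphism `ζ : ℜ → 𝔥` with
`ζ(A) = (t₀+t₁-1)(t₀+t₁+1)/4`, `ζ(B) = (t₀+t₂-1)(t₀+t₂+1)/4`,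
`ζ(C) = (t₀+t₃-1)(t₀+t₃+1)/4`; moreover it satisfies
`ζ(δ) = (t₀²+t₁²+t₂²+t₃²)/4 - t₀/2 - 3/4`. -/
theorem stmt0 (F : Type) [Field F] [IsAlgClosed F] [CharZero F] :
    (∃! ζ : RacahAlg F →ₐ[F] DAHAAlg F, IsZeta F ζ) ∧
    (∀ ζ : RacahAlg F →ₐ[F] DAHAAlg F, IsZeta F ζ →
      ζ (rDelta F) = (1 / 4 : F) • (tGen F 0 * tGen F 0 + tGen F 1 * tGen F 1
          + tGen F 2 * tGen F 2 + tGen F 3 * tGen F 3)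
        - (1 / 2 : F) • tGen F 0 - algebraMap F (DAHAAlg F) (3 / 4)) := by
  obtain ⟨ζ, hζ⟩ := exists_isZeta F
  refine ⟨⟨ζ, hζ, fun η hη => racahHom_ext F (hη.1.trans hζ.1.symm) (hη.2.1.trans hζ.2.1.symm)
    (hη.2.2.trans hζ.2.2.symm)⟩, fun η hη => ?_⟩
  rw [rDelta, map_add, map_add, hη.1, hη.2.1, hη.2.2]
  exact shifted_sq_sum (dahaSum F)
end

section
/- For any scalars a, b, c ∈ F and any integer d ≥ 0, the ℜ-module R_d(a,b,c) is irreducible if and only if none of a+b+c+1, −a+b+c, a−b+c, a+b−c belongs to the set {d/2 − i : i = 1, 2, …, d}. -/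
open FreeAlgebra

/-! ## Split sequences -/

/-- A sequence `u` spanning `V` and vanishing beyond index `d`, on which `A` and `B` act by the
bidiagonal formulas defining `R_d(a,b,c)`. -/
structure IsSplitSeq {F V : Type} [Field F] [AddCommGroup V] [Module F V]
    (A B : Module.End F V) (a b c : F) (d : ℕ) (u : ℕ → V) : Prop where
  span_eq_top : Submodule.span F (Set.range u) = ⊤
  apply_succ_d : u (d + 1) = 0
  map_A : ∀ i, A (u i) = thP F a d i • u i + u (i + 1)
  map_B_zero : B (u 0) = thP F b d 0 • u 0
  map_B_succ : ∀ i, B (u (i + 1)) = thP F b d (i + 1) • u (i + 1) + phP F a b c d (i + 1) • u i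

/-- The factor of `φᵢ₊₁` that remains after removing `(i+1)(i-d)`. -/
def phRed {F : Type} [Field F] (a b c : F) (d i : ℕ) : F :=
  (a + b + c + (d : F) / 2 - (i : F) + 1) * (a + b - c + (d : F) / 2 - (i : F))

theorem phP_succ {F : Type} [Field F] (a b c : F) (d i : ℕ) :
    phP F a b c d (i + 1) = ((i : F) + 1) * ((i : F) - d) * phRed a b c d i := by
  simp only [phP, phRed]
  push_cast
  ring

theorem thP_neg {F : Type} [Field F] [CharZero F] (a : F) {d i j : ℕ} (h : i + j = d) :
    thP F (-a - 1) d j = thP F a d i := by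
  subst h
  simp only [thP]
  push_cast
  field_simp
  ring

namespace IsSplitSeq

variable {F V : Type} [Field F] [AddCommGroup V] [Module F V]
  {A B : Module.End F V} {a b c : F} {d : ℕ} {u : ℕ → V}

theorem apply_succ (h : IsSplitSeq A B a b c d u) (i : ℕ) :
    u (i + 1) = A (u i) - thP F a d i • u i := by
  rw [h.map_A]; abel

theorem apply_eq_zero (h : IsSplitSeq A B a b c d u) {n : ℕ} (hn : d < n) : u n = 0 := by
  induction n, hn using Nat.le_induction with
  | base => exact h.apply_succ_d
  | succ n _ ih => rw [h.apply_succ, ih, map_zero, smul_zero, sub_zero]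

theorem eq_top_of_apply_zero_mem (h : IsSplitSeq A B a b c d u) {N : Submodule F V}
    (hA : ∀ x ∈ N, A x ∈ N) (h0 : u 0 ∈ N) : N = ⊤ := by
  rw [eq_top_iff, ← h.span_eq_top, Submodule.span_le]
  rintro _ ⟨i, rfl⟩
  induction i with
  | zero => exact h0
  | succ i ih =>
    rw [h.apply_succ]
    exact N.sub_mem (hA _ ih) (N.smul_mem _ ih)

/-- The span of the tail `uₖ, uₖ₊₁, …`. -/
def tail (F : Type) {V : Type} [Field F] [AddCommGroup V] [Module F V] (u : ℕ → V) (k : ℕ) :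
    Submodule F V := Submodule.span F (u '' Set.Ici k)

theorem mem_tail (u : ℕ → V) {k i : ℕ} (hi : k ≤ i) : u i ∈ tail F u k :=
  Submodule.subset_span ⟨i, hi, rfl⟩

theorem tail_le {k : ℕ} {N : Submodule F V} (hN : ∀ i, k ≤ i → u i ∈ N) : tail F u k ≤ N := by
  rw [tail, Submodule.span_le]
  rintro _ ⟨i, hi, rfl⟩
  exact hN i hi

theorem tail_eq_bot (h : IsSplitSeq A B a b c d u) : tail F u (d + 1) = ⊥ :=
  le_bot_iff.1 (tail_le fun i hi => by rw [h.apply_eq_zero hi]; exact Submodule.zero_mem _)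

theorem tail_zero (h : IsSplitSeq A B a b c d u) : tail F u 0 = ⊤ := by
  rw [eq_top_iff, ← h.span_eq_top, Submodule.span_le]
  rintro _ ⟨i, rfl⟩
  exact mem_tail u (Nat.zero_le i)

theorem exists_sub_smul_mem_tail {k : ℕ} {x : V} (hx : x ∈ tail F u k) :
    ∃ r : F, x - r • u k ∈ tail F u (k + 1) := by
  have hle : tail F u k ≤ Submodule.span F {u k} ⊔ tail F u (k + 1) := tail_le fun i hi => by
    rcases hi.eq_or_lt with rfl | hi
    · exact Submodule.mem_sup_left (Submodule.mem_span_singleton_self _)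
    · exact Submodule.mem_sup_right (mem_tail u hi)
  obtain ⟨y, hy, z, hz, rfl⟩ := Submodule.mem_sup.1 (hle hx)
  obtain ⟨r, rfl⟩ := Submodule.mem_span_singleton.1 hy
  exact ⟨r, by simpa using hz⟩

theorem finrank_le_of_span_image {k m : ℕ} (N : Submodule F V)
    (hN : N ≤ Submodule.span F (u '' Set.Ico k m)) : Module.finrank F N ≤ m - k := by
  classical
  have hfin : (u '' Set.Ico k m) = (((Finset.Ico k m).image u : Finset V) : Set V) := by simp
  rw [hfin] at hN
  calc Module.finrank F N ≤ _ := Submodule.finrank_mono hN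
    _ ≤ ((Finset.Ico k m).image u).card := finrank_span_finset_le_card _
    _ ≤ (Finset.Ico k m).card := Finset.card_image_le
    _ = m - k := Nat.card_Ico _ _

/-- If `φₖ` vanishes for some `1 ≤ k ≤ d`, the tail from `k` on is a proper nonzero subspace
invariant under `A` and `B`. -/
theorem exists_invariant (h : IsSplitSeq A B a b c d u) (hfr : Module.finrank F V = d + 1)
    {k : ℕ} (hk : k < d) (hph : phRed a b c d k = 0) :
    ∃ N : Submodule F V, N ≠ ⊥ ∧ N ≠ ⊤ ∧ (∀ x ∈ N, A x ∈ N) ∧ ∀ x ∈ N, B x ∈ N := by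
  refine ⟨tail F u (k + 1), fun hbot => ?_, fun htop => ?_, fun x hx => ?_, fun x hx => ?_⟩
  · have hz : ∀ i, k + 1 ≤ i → u i = 0 := fun i hi => by
      simpa [hbot] using mem_tail (F := F) u hi
    have := finrank_le_of_span_image (F := F) (u := u) (k := 0) (m := k + 1) ⊤ (by
      rw [← h.span_eq_top, Submodule.span_le]
      rintro _ ⟨i, rfl⟩
      rcases lt_or_ge i (k + 1) with hi | hi
      · exact Submodule.subset_span ⟨i, by simpa using hi, rfl⟩
      · rw [hz i hi]; exact Submodule.zero_mem _)
    rw [finrank_top] at this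
    omega
  · have := finrank_le_of_span_image (F := F) (u := u) (k := k + 1) (m := d + 1)
      (tail F u (k + 1)) (tail_le fun i hi => by
        rcases lt_or_ge i (d + 1) with hi' | hi'
        · exact Submodule.subset_span ⟨i, ⟨hi, hi'⟩, rfl⟩
        · rw [h.apply_eq_zero hi']; exact Submodule.zero_mem _)
    rw [htop, finrank_top] at this
    omega
  · suffices tail F u (k + 1) ≤ (tail F u (k + 1)).comap A from this hx
    refine tail_le fun i hi => ?_
    rw [Submodule.mem_comap, h.map_A]
    exact add_mem (Submodule.smul_mem _ _ (mem_tail u hi)) (mem_tail u (by omega))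
  · suffices tail F u (k + 1) ≤ (tail F u (k + 1)).comap B from this hx
    refine tail_le fun i hi => ?_
    obtain ⟨i, rfl⟩ : ∃ j, i = j + 1 := ⟨i - 1, by omega⟩
    rw [Submodule.mem_comap, h.map_B_succ]
    refine add_mem (Submodule.smul_mem _ _ (mem_tail u hi)) ?_
    rcases (Nat.le_of_succ_le_succ hi).eq_or_lt with rfl | hi'
    · rw [phP_succ, hph, mul_zero, zero_smul]; exact Submodule.zero_mem _
    · exact Submodule.smul_mem _ _ (mem_tail u hi')

/-! ### The sequence attached to the reversed eigenvalues of `A` -/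

/-- `uⱼ = (A - θ_{d-j+1}) ⋯ (A - θ_d) u₀`. -/
def flip (A : Module.End F V) (a : F) (d : ℕ) (u : ℕ → V) : ℕ → V
  | 0 => u 0
  | j + 1 => A (flip A a d u j) - thP F (-a - 1) d j • flip A a d u j

theorem map_flip (j : ℕ) : A (flip A a d u j) =
    thP F (-a - 1) d j • flip A a d u j + flip A a d u (j + 1) := by
  rw [flip]; abel

theorem racah_relation_apply [CharZero F] (h : IsSplitSeq A B a b c d u) (x : V) :
    A (A (B x)) - (2 : F) • A (B (A x)) + B (A (A x)) =
      (2 : F) • (A (B x) + B (A x) + A (A x)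
        - ((d : F) / 2 * ((d : F) / 2 + 1) + a * (a + 1) + b * (b + 1) + c * (c + 1)) • A x
        + ((c - b) * (c + b + 1) * (a - (d : F) / 2) * (a + (d : F) / 2 + 1)) • x) := by
  have hx : x ∈ Submodule.span F (Set.range u) := by rw [h.span_eq_top]; trivial
  induction hx using Submodule.span_induction with
  | zero => simp
  | add x y _ _ hx hy =>
    simp only [map_add]
    have hxy := congrArg₂ (· + ·) hx hy
    rw [← sub_eq_zero] at hxy ⊢
    rw [← hxy]
    module
  | smul r x _ hx =>
    simp only [map_smul]
    have hr := congrArg (r • ·) hx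
    rw [← sub_eq_zero] at hr ⊢
    rw [← hr]
    module
  | mem x hx =>
    obtain ⟨i, rfl⟩ := hx
    cases i with
    | zero =>
      simp only [h.map_A, h.map_B_zero, h.map_B_succ, map_add, map_smul, thP, phP]
      push_cast
      match_scalars <;> field_simp <;> ring
    | succ i =>
      simp only [h.map_A, h.map_B_succ, map_add, map_smul, thP, phP]
      push_cast
      match_scalars <;> field_simp <;> ring

theorem map_B_flip [CharZero F] (h : IsSplitSeq A B a b c d u) :
    B (flip A a d u 0) = thP F b d 0 • flip A a d u 0 ∧
    ∀ j, B (flip A a d u (j + 1)) = thP F b d (j + 1) • flip A a d u (j + 1) +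
      phP F (-a - 1) b c d (j + 1) • flip A a d u j := by
  have h0 : B (flip A a d u 0) = thP F b d 0 • flip A a d u 0 := h.map_B_zero
  have h1 : B (flip A a d u 1) = thP F b d 1 • flip A a d u 1 +
      phP F (-a - 1) b c d 1 • flip A a d u 0 := by
    have hu := h.map_B_succ 0
    simp only [flip, h.map_A, map_add, map_sub, map_smul, h.map_B_zero, hu, thP, phP]
    push_cast
    match_scalars <;> field_simp
    ring
  refine ⟨h0, fun j => ?_⟩
  induction j using Nat.twoStepInduction with
  | zero => exact h1
  | one =>
    have key := h.racah_relation_apply (flip A a d u 0)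
    simp only [map_flip, map_add, map_smul, h0, zero_add, h1] at key
    rw [← sub_eq_zero] at key ⊢
    rw [← key]
    simp only [thP, phP]
    push_cast
    match_scalars <;> field_simp <;> ring
  | more j ih₁ ih₂ =>
    have key := h.racah_relation_apply (flip A a d u (j + 1))
    simp only [map_flip, map_add, map_smul, ih₁, ih₂] at key
    rw [← sub_eq_zero] at key ⊢
    rw [← key]
    simp only [thP, phP]
    push_cast
    match_scalars <;> field_simp <;> ring

/-! ### Products of linear factors in `A` and `B` -/

open Polynomial

/-- `(A - θ_{d-j+1}) ⋯ (A - θ_d)`. -/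
noncomputable def polyA (A : Module.End F V) (a : F) (d j : ℕ) : Module.End F V :=
  aeval A (∏ h ∈ Finset.range j, (X - C (thP F (-a - 1) d h)))

/-- `(B - θ*₁) ⋯ (B - θ*ₙ)`. -/
noncomputable def polyB (B : Module.End F V) (b : F) (d n : ℕ) : Module.End F V :=
  aeval B (∏ h ∈ Finset.range n, (X - C (thP F b d (h + 1))))

theorem polyA_succ (j : ℕ) (x : V) : polyA A a d (j + 1) x =
    polyA A a d j (A x) - thP F (-a - 1) d j • polyA A a d j x := by
  simp [polyA, Finset.prod_range_succ, Algebra.algebraMap_eq_smul_one]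

theorem polyA_succ' (j : ℕ) (x : V) : polyA A a d (j + 1) x =
    A (polyA A a d j x) - thP F (-a - 1) d j • polyA A a d j x := by
  simp [polyA, Finset.prod_range_succ_comm, Algebra.algebraMap_eq_smul_one]

theorem polyB_succ (n : ℕ) (x : V) : polyB B b d (n + 1) x =
    polyB B b d n (B x) - thP F b d (n + 1) • polyB B b d n x := by
  simp [polyB, Finset.prod_range_succ, Algebra.algebraMap_eq_smul_one]

theorem polyB_succ' (n : ℕ) (x : V) : polyB B b d (n + 1) x =
    B (polyB B b d n x) - thP F b d (n + 1) • polyB B b d n x := by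
  simp [polyB, Finset.prod_range_succ_comm, Algebra.algebraMap_eq_smul_one]

theorem aeval_mem {T : Module.End F V} {N : Submodule F V} (hT : ∀ x ∈ N, T x ∈ N) (p : F[X])
    {x : V} (hx : x ∈ N) : aeval T p x ∈ N := by
  induction p using Polynomial.induction_on' with
  | add p q hp hq => rw [map_add]; exact N.add_mem hp hq
  | monomial n r =>
    rw [aeval_monomial, Module.End.mul_apply, Module.algebraMap_end_apply]
    refine N.smul_mem _ ?_
    induction n with
    | zero => simpa using hx
    | succ n ih => rw [pow_succ', Module.End.mul_apply]; exact hT _ ih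

theorem flip_eq_polyA (j : ℕ) : flip A a d u j = polyA A a d j (u 0) := by
  induction j with
  | zero => simp [flip, polyA]
  | succ j ih => rw [flip, ih, polyA_succ']

theorem polyA_succ_apply (h : IsSplitSeq A B a b c d u) (i j : ℕ) :
    polyA A a d (j + 1) (u i) =
      polyA A a d j (u (i + 1)) + (thP F a d i - thP F (-a - 1) d j) • polyA A a d j (u i) := by
  rw [polyA_succ, h.map_A, map_add, map_smul]
  module

theorem polyA_apply_eq_zero [CharZero F] (h : IsSplitSeq A B a b c d u) {i j : ℕ} (hij : d < i + j) :
    polyA A a d j (u i) = 0 := by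
  induction j generalizing i with
  | zero => rw [h.apply_eq_zero (by simpa using hij), map_zero]
  | succ j ih =>
    rw [h.polyA_succ_apply, ih (by omega)]
    rcases (show d ≤ i + j by omega).eq_or_lt with hd | hd
    · rw [thP_neg a hd.symm, sub_self, zero_smul, zero_add]
    · rw [ih hd, smul_zero, zero_add]

/-- Reversing the eigenvalues of `A` turns a split sequence with parameters `a, b, c` into one
with parameters `-a - 1, b, c`. -/
theorem isSplitSeq_flip [CharZero F] (h : IsSplitSeq A B a b c d u) :
    IsSplitSeq A B (-a - 1) b c d (flip A a d u) where
  span_eq_top := by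
    refine h.eq_top_of_apply_zero_mem (fun x hx => ?_) (Submodule.subset_span ⟨0, rfl⟩)
    suffices Submodule.span F (Set.range (flip A a d u)) ≤
      (Submodule.span F (Set.range (flip A a d u))).comap A from this hx
    rw [Submodule.span_le]
    rintro _ ⟨j, rfl⟩
    rw [SetLike.mem_coe, Submodule.mem_comap, map_flip]
    exact add_mem (Submodule.smul_mem _ _ (Submodule.subset_span ⟨j, rfl⟩))
      (Submodule.subset_span ⟨j + 1, rfl⟩)
  apply_succ_d := by rw [flip_eq_polyA, h.polyA_apply_eq_zero (by omega)]
  map_A := map_flip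
  map_B_zero := h.map_B_flip.1
  map_B_succ := h.map_B_flip.2

/-- The normalizing factor in `polyB_polyA_apply`. -/
def weight (b : F) (d n : ℕ) : F :=
  (∏ h ∈ Finset.range n, ((h : F) + 1) * ((h : F) - d)) *
    ∏ h ∈ Finset.Ico n d, ((h : F) + 1) * (2 * b + d - h)

theorem weight_succ {n : ℕ} (hn : n < d) :
    weight b d (n + 1) * (2 * b + d - n) = weight b d n * ((n : F) - d) := by
  rw [weight, weight, Finset.prod_range_succ, Finset.prod_eq_prod_Ico_succ_bot hn]
  ring

theorem polyB_apply (h : IsSplitSeq A B a b c d u) {i n : ℕ} (hi : i ≤ n) :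
    polyB B b d n (u i) = ((∏ k ∈ Finset.range i, phP F a b c d (k + 1)) *
      ∏ k ∈ Finset.Ico i n, (thP F b d 0 - thP F b d (k + 1))) • u 0 := by
  induction n generalizing i with
  | zero => obtain rfl : i = 0 := by omega
            simp [polyB]
  | succ n ih =>
    rcases hi.eq_or_lt with rfl | hi
    · rw [polyB_succ, h.map_B_succ, map_add, map_smul, map_smul, add_sub_cancel_left,
        ih le_rfl, Finset.prod_range_succ]
      simp only [Finset.Ico_self, Finset.prod_empty, smul_smul]
      ring_nf
    · have hi' : i ≤ n := by omega
      rw [polyB_succ', ih hi', map_smul, h.map_B_zero, Finset.prod_Ico_succ_top hi']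
      module

theorem polyB_polyA_apply [CharZero F] (h : IsSplitSeq A B a b c d u) {i j : ℕ}
    (hij : i + j ≤ d) :
    polyB B b d d (polyA A a d j (u i)) =
      ((∏ k ∈ Finset.range i, phRed a b c d k) *
        (∏ k ∈ Finset.range j, phRed (-a - 1) b c d k) * weight b d (i + j)) • u 0 := by
  induction j generalizing i with
  | zero =>
    have hA : polyA A a d 0 (u i) = u i := by simp [polyA]
    have hth : ∀ k : ℕ, thP F b d 0 - thP F b d (k + 1) = ((k : F) + 1) * (2 * b + d - k) := by
      intro k
      simp only [thP]
      push_cast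
      field_simp
      ring
    rw [hA, h.polyB_apply (by simpa using hij)]
    simp only [hth, phP_succ, Finset.prod_mul_distrib, weight, add_zero, Finset.prod_range_zero]
    congr 1
    ring
  | succ j ih =>
    have hw := weight_succ (b := b) (show i + j < d by omega)
    have hred : phRed (-a - 1) b c d j - phRed a b c d i =
        ((i : F) - j - 2 * a - 1) * (2 * b + d - (i + j : ℕ)) := by
      simp only [phRed]
      push_cast
      field_simp
      ring
    have hth : thP F a d i - thP F (-a - 1) d j =
        ((i : F) - j - 2 * a - 1) * ((i + j : ℕ) - d) := by
      simp only [thP]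
      push_cast
      field_simp
      ring
    rw [h.polyA_succ_apply, map_add, map_smul, ih (by omega), ih (by omega), smul_smul,
      ← add_smul, hth, Finset.prod_range_succ, Finset.prod_range_succ,
      show i + 1 + j = i + j + 1 by ring, show i + (j + 1) = i + j + 1 by ring]
    congr 1
    linear_combination (∏ k ∈ Finset.range i, phRed a b c d k) *
        (∏ k ∈ Finset.range j, phRed (-a - 1) b c d k) *
        (-((i : F) - j - 2 * a - 1) * hw - weight b d (i + j + 1) * hred)

theorem weight_self_ne_zero [CharZero F] : weight b d d ≠ 0 := by
  rw [weight, Finset.Ico_self, Finset.prod_empty, mul_one, Finset.prod_ne_zero_iff]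
  intro h hh
  refine mul_ne_zero (Nat.cast_add_one_ne_zero h) (sub_ne_zero.2 ?_)
  exact_mod_cast (Finset.mem_range.1 hh).ne

/-- If no `φᵢ` vanishes, neither for `a` nor for `-a - 1`, then there is no proper nonzero
subspace invariant under `A` and `B`. -/
theorem eq_top_of_invariant [CharZero F] (h : IsSplitSeq A B a b c d u)
    (h₁ : ∀ i < d, phRed a b c d i ≠ 0) (h₂ : ∀ i < d, phRed (-a - 1) b c d i ≠ 0)
    {N : Submodule F V} (hN : N ≠ ⊥) (hA : ∀ x ∈ N, A x ∈ N) (hB : ∀ x ∈ N, B x ∈ N) :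
    N = ⊤ := by
  obtain ⟨x, hxN, hx0⟩ := N.ne_bot_iff.1 hN
  obtain ⟨k, hkd, hxk, hxk'⟩ : ∃ k ≤ d, x ∈ tail F u k ∧ x ∉ tail F u (k + 1) := by
    by_contra! hcon
    have hall : ∀ k ≤ d + 1, x ∈ tail F u k := by
      intro k hk
      induction k with
      | zero => rw [h.tail_zero]; trivial
      | succ k ih => exact hcon k (by omega) (ih (by omega))
    exact hx0 (by simpa [h.tail_eq_bot] using hall (d + 1) le_rfl)
  obtain ⟨r, hr⟩ := exists_sub_smul_mem_tail hxk
  have hr0 : r ≠ 0 := by rintro rfl; exact hxk' (by simpa using hr)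
  obtain ⟨j, rfl⟩ := Nat.exists_eq_add_of_le hkd
  have hker : polyA A a (k + j) j (x - r • u k) = 0 := by
    suffices tail F u (k + 1) ≤ LinearMap.ker (polyA A a (k + j) j) from this hr
    exact tail_le fun i hi => h.polyA_apply_eq_zero (by omega)
  rw [map_sub, map_smul, sub_eq_zero] at hker
  have hmem : polyB B b (k + j) (k + j) (polyA A a (k + j) j x) ∈ N :=
    aeval_mem hB _ (aeval_mem hA _ hxN)
  rw [hker, map_smul, h.polyB_polyA_apply le_rfl, smul_smul] at hmem
  refine h.eq_top_of_apply_zero_mem hA ((N.smul_mem_iff (mul_ne_zero hr0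
    (mul_ne_zero (mul_ne_zero ?_ ?_) weight_self_ne_zero))).1 hmem)
  · exact Finset.prod_ne_zero_iff.2 fun i hi => h₁ i (by simp at hi; omega)
  · exact Finset.prod_ne_zero_iff.2 fun i hi => h₂ i (by simp at hi; omega)

end IsSplitSeq

/-! ## Submodules of `R_d(a,b,c)` -/

theorem two_mul_rD (F : Type) [Field F] : rA F * rB F - rB F * rA F = 2 * rD F := by
  have h := RingQuot.mkAlgHom_rel F (RacahRel.AB (F := F))
  simp only [map_sub, map_mul, map_ofNat] at h
  exact h

theorem smul_mem_of_generators {F V : Type} [Field F] [CharZero F] [AddCommGroup V]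
    [Module F V] [Module (RacahAlg F) V] [IsScalarTower F (RacahAlg F) V] {δ : F}
    (hδ : ∀ x : V, rDelta F • x = δ • x) {N : Submodule F V}
    (hA : ∀ x ∈ N, rA F • x ∈ N) (hB : ∀ x ∈ N, rB F • x ∈ N) (r : RacahAlg F) {x : V}
    (hx : x ∈ N) : r • x ∈ N := by
  have hC : ∀ x ∈ N, rC F • x ∈ N := fun x hx => by
    have : rC F • x = δ • x - rA F • x - rB F • x := by
      rw [← hδ, rDelta, add_smul, add_smul]; abel
    rw [this]
    exact N.sub_mem (N.sub_mem (N.smul_mem _ hx) (hA x hx)) (hB x hx)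
  have hD : ∀ x ∈ N, rD F • x ∈ N := fun x hx => by
    have h2 : (2 : F) • rD F • x = rA F • rB F • x - rB F • rA F • x := by
      rw [← mul_smul, ← mul_smul, ← sub_smul, two_mul_rD, two_mul, add_smul, two_smul]
    refine (N.smul_mem_iff (two_ne_zero (α := F))).1 ?_
    rw [h2]
    exact N.sub_mem (hA _ (hB x hx)) (hB _ (hA x hx))
  obtain ⟨p, rfl⟩ := RingQuot.mkAlgHom_surjective F (RacahRel F) r
  induction p using FreeAlgebra.induction generalizing x with
  | grade0 s => rw [AlgHom.commutes, algebraMap_smul]; exact N.smul_mem _ hx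
  | grade1 i =>
    fin_cases i
    exacts [hA x hx, hB x hx, hC x hx, hD x hx]
  | mul p q hp hq => rw [map_mul, mul_smul]; exact hp (hq hx)
  | add p q hp hq => rw [map_add, add_smul]; exact N.add_mem (hp hx) (hq hx)

theorem isSimpleModule_iff_invariant {F V : Type} [Field F] [CharZero F] [AddCommGroup V]
    [Nontrivial V] [Module F V] [Module (RacahAlg F) V] [IsScalarTower F (RacahAlg F) V] {δ : F}
    (hδ : ∀ x : V, rDelta F • x = δ • x) :
    IsSimpleModule (RacahAlg F) V ↔ ∀ N : Submodule F V, N ≠ ⊥ →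
      (∀ x ∈ N, opOf F (rA F) V x ∈ N) → (∀ x ∈ N, opOf F (rB F) V x ∈ N) → N = ⊤ := by
  constructor
  · intro hs N hN hA hB
    let M : Submodule (RacahAlg F) V :=
      { N with smul_mem' := fun r x hx => smul_mem_of_generators hδ hA hB r hx }
    have hM : ∀ x, x ∈ M ↔ x ∈ N := fun x => Iff.rfl
    rcases eq_bot_or_eq_top M with h | h
    · refine absurd ((Submodule.eq_bot_iff N).2 fun x hx => ?_) hN
      simpa [h] using (hM x).2 hx
    · exact eq_top_iff.2 fun x _ => (hM x).1 (h ▸ Submodule.mem_top)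
  · intro hN
    rw [isSimpleModule_iff]
    refine { eq_bot_or_eq_top := fun M => or_iff_not_imp_left.2 fun hM => ?_ }
    have := hN (M.restrictScalars F) (by simpa using hM)
      (fun x hx => M.smul_mem _ hx) (fun x hx => M.smul_mem _ hx)
    simpa using this

theorem IsRdModule.exists_isSplitSeq {F V : Type} [Field F] {a b c : F} {d : ℕ}
    [AddCommGroup V] [Module (RacahAlg F) V] (hV : IsRdModule F a b c d V) :
    letI := resF F (RacahAlg F) V
    haveI := resF_tower F (RacahAlg F) V rfl
    Module.finrank F V = d + 1 ∧
      (∃ u : ℕ → V, IsSplitSeq (opOf F (rA F) V) (opOf F (rB F) V) a b c d u) ∧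
      ∃ δ : F, ∀ x : V, rDelta F • x = δ • x := by
  let := resF F (RacahAlg F) V
  have := resF_tower F (RacahAlg F) V rfl
  obtain ⟨v, hA, hB, hδ⟩ := hV
  refine ⟨by simp [Module.finrank_eq_card_basis v],
    ⟨fun n => if h : n < d + 1 then v ⟨n, h⟩ else 0, ?_, by simp, fun i => ?_, ?_, fun i => ?_⟩,
    _, hδ⟩
  · rw [eq_top_iff, ← v.span_eq]
    refine Submodule.span_mono ?_
    rintro _ ⟨i, rfl⟩
    exact ⟨i, by simp only [i.isLt, dif_pos, Fin.eta]⟩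
  · by_cases hi : i < d + 1
    · simp only [hi, dif_pos]
      exact hA ⟨i, hi⟩
    · have hi' : ¬ i + 1 < d + 1 := by omega
      simp [hi, hi']
  · have := hB 0
    simp only [Fin.val_zero, if_true, add_zero] at this
    simp only [Nat.succ_pos, dif_pos]
    exact this
  · by_cases hi : i + 1 < d + 1
    · have hi' : i < d + 1 := by omega
      simp only [hi, hi', dif_pos]
      exact hB ⟨i + 1, hi⟩
    · by_cases hi' : i < d + 1
      · obtain rfl : i = d := by omega
        simp [phP]
      · simp [hi, hi']

theorem phRed_ne_zero_iff {F : Type} [Field F] [CharZero F] (a b c : F) (d : ℕ) :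
    (∀ i < d, phRed a b c d i ≠ 0) ↔ ∀ i : ℕ, 1 ≤ i → i ≤ d →
      a + b + c + 1 ≠ (d : F) / 2 - (i : F) ∧ a + b - c ≠ (d : F) / 2 - (i : F) := by
  have key : ∀ i j : ℕ, i + j = d → (phRed a b c d i ≠ 0 ↔
      a + b + c + 1 ≠ (d : F) / 2 - (j : F) ∧ a + b - c ≠ (d : F) / 2 - (j : F)) := by
    rintro i j rfl
    rw [phRed, mul_ne_zero_iff, ← sub_ne_zero (b := ((i + j : ℕ) : F) / 2 - (j : F)),
      ← sub_ne_zero (a := a + b - c)]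
    push_cast
    ring_nf
  constructor
  · intro h i hi hid
    exact (key (d - i) i (by omega)).1 (h _ (by omega))
  · intro h i hi
    exact (key i (d - i) (by omega)).2 (h _ (by omega) (by omega))

/-- `R_d(a,b,c)` is irreducible iff none of `a+b+c+1, -a+b+c, a-b+c, a+b-c`
belongs to `{d/2 - i : i = 1, …, d}`. -/
theorem stmt5 (F : Type) [Field F] [IsAlgClosed F] [CharZero F] (a b c : F) (d : ℕ)
    (V : Type) [AddCommGroup V] [Module (RacahAlg F) V]
    (hV : IsRdModule F a b c d V) :
    IsSimpleModule (RacahAlg F) V ↔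
      (∀ i : ℕ, 1 ≤ i → i ≤ d →
        a + b + c + 1 ≠ (d : F) / 2 - (i : F) ∧
        -a + b + c ≠ (d : F) / 2 - (i : F) ∧
        a - b + c ≠ (d : F) / 2 - (i : F) ∧
        a + b - c ≠ (d : F) / 2 - (i : F)) := by
  let := resF F (RacahAlg F) V
  have := resF_tower F (RacahAlg F) V rfl
  obtain ⟨hfr, ⟨u, hu⟩, δ, hδ⟩ := hV.exists_isSplitSeq
  have : Nontrivial V := Module.nontrivial_of_finrank_pos (R := F) (by omega)
  have hcond : (∀ i : ℕ, 1 ≤ i → i ≤ d →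
        a + b + c + 1 ≠ (d : F) / 2 - (i : F) ∧
        -a + b + c ≠ (d : F) / 2 - (i : F) ∧
        a - b + c ≠ (d : F) / 2 - (i : F) ∧
        a + b - c ≠ (d : F) / 2 - (i : F)) ↔
      (∀ i < d, phRed a b c d i ≠ 0) ∧ ∀ i < d, phRed (-a - 1) b c d i ≠ 0 := by
    have hneg : ∀ i j : ℕ, i + j = d + 1 →
        (-a - 1 + b - c = (d : F) / 2 - i ↔ a - b + c = (d : F) / 2 - j) := by
      intro i j hij
      have hij' : (i : F) + j = d + 1 := by exact_mod_cast hij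
      constructor <;> intro h <;> linear_combination -h + hij'
    have hadd : -a - 1 + b + c + 1 = -a + b + c := by ring
    rw [phRed_ne_zero_iff, phRed_ne_zero_iff]
    constructor
    · refine fun h => ⟨fun i h1 hd => ⟨(h i h1 hd).1, (h i h1 hd).2.2.2⟩, fun i h1 hd => ⟨?_, ?_⟩⟩
      · rw [hadd]; exact (h i h1 hd).2.1
      · rw [Ne, hneg i (d + 1 - i) (by omega)]
        exact (h _ (by omega) (by omega)).2.2.1
    · refine fun h i h1 hd => ⟨(h.1 i h1 hd).1, ?_, ?_, (h.1 i h1 hd).2⟩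
      · rw [← hadd]; exact (h.2 i h1 hd).1
      · rw [Ne, ← hneg (d + 1 - i) i (by omega)]
        exact (h.2 _ (by omega) (by omega)).2
  rw [hcond, isSimpleModule_iff_invariant hδ]
  constructor
  · intro hs
    constructor <;> intro i hi h0
    · obtain ⟨N, hbot, htop, hA, hB⟩ := hu.exists_invariant hfr hi h0
      exact htop (hs N hbot hA hB)
    · obtain ⟨N, hbot, htop, hA, hB⟩ := hu.isSplitSeq_flip.exists_invariant hfr hi h0
      exact htop (hs N hbot hA hB)
  · rintro ⟨h₁, h₂⟩ N hN hA hB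
    exact hu.eq_top_of_invariant h₁ h₂ hN hA hB
end

section
/- Let d ≥ 0 be an integer and suppose V is a (d+1)-dimensional irreducible ℜ-module. Then there exist a, b, c ∈ F such that the ℜ-module R_d(a,b,c) is isomorphic to V. -/
open FreeAlgebra

section RacahPair

open Module

variable {F V : Type} [Field F] [AddCommGroup V] [Module F V]

/-- The two relations satisfied by a pair of generators of the Racah algebra on a module on
which the central elements act as scalars. -/
structure IsRacahPair (X Y : End F V) (δ p q : F) : Prop where
  left (u : V) : X (X (Y u)) - (2 : F) • X (Y (X u)) + Y (X (X u)) =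
    (2 : F) • X (Y u) + (2 : F) • Y (X u) + (2 : F) • X (X u) - (2 * δ) • X u + (2 * p) • u
  right (u : V) : Y (Y (X u)) - (2 : F) • Y (X (Y u)) + X (Y (Y u)) =
    (2 : F) • Y (X u) + (2 : F) • X (Y u) + (2 : F) • Y (Y u) - (2 * δ) • Y u + (2 * q) • u

theorem IsRacahPair.symm {X Y : End F V} {δ p q : F} (h : IsRacahPair X Y δ p q) :
    IsRacahPair Y X δ q p := ⟨h.right, h.left⟩

/-- No proper nonzero subspace is invariant under both `X` and `Y`. -/
def IsIrreduciblePair (X Y : End F V) : Prop :=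
  ∀ W : Submodule F V, (∀ w ∈ W, X w ∈ W) → (∀ w ∈ W, Y w ∈ W) → W = ⊥ ∨ W = ⊤

theorem IsIrreduciblePair.symm {X Y : End F V} (h : IsIrreduciblePair X Y) :
    IsIrreduciblePair Y X := fun W hY hX => h W hX hY

/-- Among the eigenvalues of `Y` there is one of the form `y(y+1)` such that `(y+1)(y+2)` is not
an eigenvalue. -/
theorem exists_extremal_eigenvalue [IsAlgClosed F] [CharZero F] [FiniteDimensional F V]
    [Nontrivial V] (Y : End F V) :
    ∃ y : F, Y.HasEigenvalue (y * (y + 1)) ∧ ¬ Y.HasEigenvalue ((y + 1) * (y + 2)) := by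
  obtain ⟨μ, hμ⟩ := Module.End.exists_eigenvalue Y
  obtain ⟨s, hs⟩ := IsAlgClosed.exists_pow_nat_eq (1 + 4 * μ) (n := 2) (by norm_num)
  set z : F := (s - 1) / 2 with hz
  have hzμ : z * (z + 1) = μ := by
    have : z * (z + 1) = (s ^ 2 - 1) / 4 := by rw [hz]; ring
    rw [this, hs]; ring
  by_contra! hcon
  have hall : ∀ n : ℕ, Y.HasEigenvalue ((z + n) * (z + n + 1)) := by
    intro n
    induction n with
    | zero => simpa [hzμ] using hμ
    | succ n ih =>
      have h2 := hcon _ ih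
      convert h2 using 1
      push_cast; ring
  set r : Polynomial F := Polynomial.X ^ 2 + Polynomial.C (2 * z + 1) * Polynomial.X
    + Polynomial.C (z * (z + 1)) with hr
  have hrdeg : r.natDegree = 2 := by rw [hr]; compute_degree!
  have h0 : Y.charpoly.comp r = 0 := by
    apply Polynomial.eq_zero_of_infinite_isRoot
    refine (Set.infinite_range_of_injective (Nat.cast_injective (R := F))).mono ?_
    rintro _ ⟨n, rfl⟩
    have h1 := (Module.End.hasEigenvalue_iff_isRoot_charpoly Y _).1 (hall n)
    have h2 : r.eval (n : F) = (z + n) * (z + n + 1) := by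
      rw [hr]; simp; ring
    simpa [Polynomial.IsRoot, Polynomial.eval_comp, h2] using h1
  have h1 := congrArg Polynomial.natDegree h0
  rw [Polynomial.natDegree_comp, hrdeg, LinearMap.charpoly_natDegree] at h1
  have : 0 < finrank F V := finrank_pos
  simp at h1
  omega

/-- A highest weight vector for a Racah pair. -/
structure IsHighestWeight (X Y : End F V) (δ q y κ : F) (v : V) : Prop where
  ne_zero : v ≠ 0
  eigen : Y v = (y * (y + 1)) • v
  weight_ne : y + 1 ≠ 0
  raise : Y (X v) = ((y - 1) * y) • X v + κ • v
  coeff : κ * (-2 * (y + 1)) = 2 * (y * (y + 1)) ^ 2 - 2 * δ * (y * (y + 1)) + 2 * q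

theorem IsRacahPair.exists_highestWeight [IsAlgClosed F] [CharZero F] [FiniteDimensional F V]
    [Nontrivial V] {X Y : End F V} {δ p q : F} (h : IsRacahPair X Y δ p q) :
    ∃ (y κ : F) (v : V), IsHighestWeight X Y δ q y κ v := by
  obtain ⟨y, hy, hy'⟩ := exists_extremal_eigenvalue Y
  obtain ⟨v, hv⟩ := hy.exists_hasEigenvector
  have hYv : Y v = (y * (y + 1)) • v := hv.apply_eq_smul
  have hy1 : y + 1 ≠ 0 := by
    intro h0
    apply hy'
    rw [h0, zero_mul]
    rwa [h0, mul_zero] at hy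
  have h2 : -2 * (y + 1) ≠ 0 := mul_ne_zero (by norm_num) hy1
  set κ : F := (2 * (y * (y + 1)) ^ 2 - 2 * δ * (y * (y + 1)) + 2 * q) / (-2 * (y + 1)) with hκ
  have hκ' : κ * (-2 * (y + 1)) = 2 * (y * (y + 1)) ^ 2 - 2 * δ * (y * (y + 1)) + 2 * q := by
    rw [hκ, div_mul_cancel₀ _ h2]
  refine ⟨y, κ, v, hv.2, hYv, hy1, ?_, hκ'⟩
  by_contra hne
  apply hy'
  apply Module.End.hasEigenvalue_of_hasEigenvector
    (x := Y (X v) - ((y - 1) * y) • X v - κ • v)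
  refine ⟨?_, ?_⟩
  · rw [Module.End.mem_eigenspace_iff]
    have hr := h.right v
    simp only [hYv, map_smul] at hr
    have hq : (2 * q) • v = (κ * (-2 * (y + 1)) - 2 * (y * (y + 1)) ^ 2
      + 2 * δ * (y * (y + 1))) • v := by rw [hκ']; congr 1; ring
    simp only [map_sub, map_smul, hYv]
    linear_combination (norm := module) hr + hq
  · intro h0
    apply hne
    rw [sub_sub] at h0
    exact sub_eq_zero.1 h0

/-- The eigenvalues of `Y` form a quadratic string starting at a highest weight. -/
theorem IsHighestWeight.exists_triangular_basis {X Y : End F V} {δ p q y κ : F} {v : V} {d : ℕ}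
    (hv : IsHighestWeight X Y δ q y κ v) (h : IsRacahPair X Y δ p q)
    (hirr : IsIrreduciblePair X Y) (hdim : finrank F V = d + 1) :
    ∃ b : Basis (Fin (d + 1)) F V,
      (∀ i j, j < i → LinearMap.toMatrix b b Y i j = 0) ∧
      ∀ i : Fin (d + 1),
        LinearMap.toMatrix b b Y i i = (y - (i : ℕ)) * (y - (i : ℕ) + 1) := by
  have : FiniteDimensional F V := FiniteDimensional.of_finrank_pos (by omega)
  set w : ℕ → V := fun k => (X ^ k) v with hw
  have hXw : ∀ k, X (w k) = w (k + 1) := fun k => by simp [hw, pow_succ']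
  set S : ℕ → Submodule F V := fun n => Submodule.span F (w '' Set.Iio n) with hS
  have hSmono : Monotone S := fun m n hmn =>
    Submodule.span_mono (Set.image_mono (Set.Iio_subset_Iio hmn))
  have hwS : ∀ k n, k < n → w k ∈ S n := fun k n hk =>
    Submodule.subset_span ⟨k, hk, rfl⟩
  have hXS : ∀ n, ∀ u ∈ S n, X u ∈ S (n + 1) := by
    intro n u hu
    induction hu using Submodule.span_induction with
    | mem u hu =>
      obtain ⟨k, hk, rfl⟩ := hu
      rw [hXw]; exact hwS _ _ (Nat.succ_lt_succ hk)
    | zero => simp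
    | add u u' _ _ hu hu' => rw [map_add]; exact add_mem hu hu'
    | smul c u _ hu => rw [map_smul]; exact Submodule.smul_mem _ _ hu
  have key : ∀ k : ℕ, Y (w k) - ((y - k) * (y - k + 1)) • w k ∈ S k := by
    intro k
    induction k using Nat.twoStepInduction with
    | zero => simp [hw, hv.eigen]
    | one =>
      have : Y (w 1) - ((y - (1 : ℕ)) * (y - (1 : ℕ) + 1)) • w 1 = κ • w 0 := by
        have := hv.raise
        simp only [hw, pow_one, pow_zero, Module.End.one_apply, this]
        push_cast
        module
      rw [this]
      exact Submodule.smul_mem _ _ (hwS _ _ one_pos)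
    | more k ih0 ih1 =>
      have hl := h.left (w k)
      simp only [hXw] at hl
      set e0 := Y (w k) - ((y - k) * (y - k + 1)) • w k with he0
      set e1 := Y (w (k + 1)) - ((y - (k + 1 : ℕ)) * (y - (k + 1 : ℕ) + 1)) • w (k + 1) with he1
      have hY0 : Y (w k) = e0 + ((y - k) * (y - k + 1)) • w k := by rw [he0]; abel
      have hY1 : Y (w (k + 1)) = e1 + ((y - (k + 1 : ℕ)) * (y - (k + 1 : ℕ) + 1)) • w (k + 1) := by
        rw [he1]; abel
      have hX1 : ∀ u ∈ S k, X u ∈ S (k + 2) := fun u hu => hSmono (Nat.le_succ _) (hXS _ _ hu)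
      have hX2 : ∀ u ∈ S k, X (X u) ∈ S (k + 2) := fun u hu => hXS _ _ (hXS _ _ hu)
      have heq : Y (w (k + 2)) - ((y - (k + 2 : ℕ)) * (y - (k + 2 : ℕ) + 1)) • w (k + 2) =
          (2 : F) • X e1 - X (X e0) + (2 : F) • X e0 + (2 : F) • e1
          + (2 * ((y - k) * (y - k + 1)) + 2 * ((y - (k + 1 : ℕ)) * (y - (k + 1 : ℕ) + 1))
            - 2 * δ) • w (k + 1) + (2 * p) • w k := by
        rw [hY0, hY1] at hl
        simp only [map_add, map_smul, hXw] at hl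
        push_cast at hl ⊢
        linear_combination (norm := module) hl
      rw [heq]
      refine add_mem (add_mem (add_mem (add_mem (sub_mem ?_ ?_) ?_) ?_) ?_) ?_
      · exact Submodule.smul_mem _ _ (hXS _ _ ih1)
      · exact hX2 _ ih0
      · exact Submodule.smul_mem _ _ (hX1 _ ih0)
      · exact Submodule.smul_mem _ _ (hSmono (Nat.le_succ _) ih1)
      · exact Submodule.smul_mem _ _ (hwS _ _ (by omega))
      · exact Submodule.smul_mem _ _ (hwS _ _ (by omega))
  have hwd : w (d + 1) ∈ S (d + 1) := by
    have hCH := congrArg (fun f : End F V => f v) (LinearMap.aeval_self_charpoly X)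
    have hdeg : X.charpoly.natDegree = d + 1 := by rw [LinearMap.charpoly_natDegree, hdim]
    have hmon : X.charpoly.coeff (d + 1) = 1 := by
      rw [← hdeg]; exact LinearMap.charpoly_monic X
    simp only [Polynomial.aeval_eq_sum_range, hdeg, LinearMap.sum_apply, LinearMap.smul_apply,
      LinearMap.zero_apply] at hCH
    rw [Finset.sum_range_succ, hmon, one_smul] at hCH
    have : w (d + 1) = -∑ i ∈ Finset.range (d + 1), X.charpoly.coeff i • w i :=
      eq_neg_of_add_eq_zero_right hCH
    rw [this]
    exact neg_mem (sum_mem fun i hi => Submodule.smul_mem _ _ (hwS _ _ (Finset.mem_range.1 hi)))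
  have hYS : ∀ k, Y (w k) ∈ S (k + 1) := by
    intro k
    have := add_mem (hSmono (Nat.le_succ k) (key k))
      (Submodule.smul_mem (S (k + 1)) ((y - k) * (y - k + 1)) (hwS k (k + 1) (by omega)))
    simpa using this
  have hinv : ∀ T : End F V, (∀ k, k < d + 1 → T (w k) ∈ S (d + 1)) →
      ∀ u ∈ S (d + 1), T u ∈ S (d + 1) := by
    intro T hT u hu
    have : S (d + 1) ≤ (S (d + 1)).comap T := by
      apply Submodule.span_le.2
      rintro _ ⟨k, hk, rfl⟩
      exact hT k hk
    exact this hu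
  have htop : S (d + 1) = ⊤ := by
    refine (hirr (S (d + 1)) (hinv X ?_) (hinv Y ?_)).resolve_left ?_
    · intro k hk
      rw [hXw]
      rcases Nat.lt_or_ge (k + 1) (d + 1) with h1 | h1
      · exact hwS _ _ h1
      · rwa [show k + 1 = d + 1 by omega]
    · intro k hk
      exact hSmono (Nat.succ_le_of_lt hk) (hYS k)
    · intro hbot
      have := hwS 0 (d + 1) (by omega)
      rw [hbot, Submodule.mem_bot] at this
      exact hv.ne_zero (by simpa [hw] using this)
  have hrange : Set.range (fun i : Fin (d + 1) => w i) = w '' Set.Iio (d + 1) := by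
    ext u
    constructor
    · rintro ⟨i, rfl⟩; exact ⟨i, i.2, rfl⟩
    · rintro ⟨k, hk, rfl⟩; exact ⟨⟨k, hk⟩, rfl⟩
  let b : Basis (Fin (d + 1)) F V := basisOfTopLeSpanOfCardEqFinrank (fun i => w i)
    (by rw [hrange]; exact htop.ge) (by simp [hdim])
  have hb : ∀ i, b i = w i := fun i => by simp [b]
  have hrepr : ∀ (n : ℕ) (u : V), u ∈ S n → ∀ i : Fin (d + 1), n ≤ i → n ≤ d + 1 →
      b.repr u i = 0 := by
    intro n u hu i hi hn
    have : S n ≤ LinearMap.ker (b.coord i) := by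
      apply Submodule.span_le.2
      rintro _ ⟨k, hk, rfl⟩
      have hk' : k < n := hk
      have : w k = b ⟨k, by omega⟩ := (hb ⟨k, by omega⟩).symm
      rw [this]
      have hne : (⟨k, by omega⟩ : Fin (d + 1)) ≠ i := by
        intro h; rw [← h] at hi; simp at hi; omega
      simp [hne]
    exact this hu
  refine ⟨b, fun i j hij => ?_, fun i => ?_⟩
  · rw [LinearMap.toMatrix_apply, hb]
    exact hrepr _ _ (hYS j) i (by simpa using hij) (by omega)
  · have h1 := hrepr _ _ (key i) i le_rfl (by omega)
    rw [LinearMap.toMatrix_apply, hb]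
    rw [map_sub, map_smul, ← hb] at h1
    simp at h1
    rw [← hb]
    exact sub_eq_zero.1 h1

theorem IsHighestWeight.charpoly_eq {X Y : End F V} {δ p q y κ : F} {v : V} {d : ℕ}
    (hv : IsHighestWeight X Y δ q y κ v) (h : IsRacahPair X Y δ p q)
    [FiniteDimensional F V] (hirr : IsIrreduciblePair X Y) (hdim : finrank F V = d + 1) :
    Y.charpoly = ∏ i ∈ Finset.range (d + 1),
      (Polynomial.X - Polynomial.C ((y - (i : F)) * (y - (i : F) + 1))) := by
  obtain ⟨b, hb, hd⟩ := hv.exists_triangular_basis h hirr hdim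
  rw [← LinearMap.charpoly_toMatrix Y b, Matrix.charpoly_of_isUpperTriangular _
    (fun i j hij => hb i j hij), Finset.prod_range]
  simp only [hd]

theorem IsHighestWeight.trace_eq {X Y : End F V} {δ p q y κ : F} {v : V} {d : ℕ}
    (hv : IsHighestWeight X Y δ q y κ v) (h : IsRacahPair X Y δ p q)
    (hirr : IsIrreduciblePair X Y) (hdim : finrank F V = d + 1) :
    LinearMap.trace F V Y = ∑ i ∈ Finset.range (d + 1), (y - (i : F)) * (y - (i : F) + 1) := by
  obtain ⟨b, hb, hd⟩ := hv.exists_triangular_basis h hirr hdim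
  rw [LinearMap.trace_eq_matrix_trace F b, Matrix.trace, Finset.sum_range]
  simp only [Matrix.diag, hd]

theorem IsHighestWeight.trace_mul_self_eq {X Y : End F V} {δ p q y κ : F} {v : V} {d : ℕ}
    (hv : IsHighestWeight X Y δ q y κ v) (h : IsRacahPair X Y δ p q)
    (hirr : IsIrreduciblePair X Y) (hdim : finrank F V = d + 1) :
    LinearMap.trace F V (Y * Y) =
      ∑ i ∈ Finset.range (d + 1), ((y - (i : F)) * (y - (i : F) + 1)) ^ 2 := by
  obtain ⟨b, hb, hd⟩ := hv.exists_triangular_basis h hirr hdim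
  rw [LinearMap.trace_eq_matrix_trace F b, LinearMap.toMatrix_mul, Matrix.trace, Finset.sum_range]
  refine Finset.sum_congr rfl fun i _ => ?_
  rw [Matrix.diag, Matrix.mul_apply, Finset.sum_eq_single i, hd, sq]
  · intro j _ hj
    rcases lt_or_gt_of_ne hj with h1 | h1
    · rw [hb i j h1, zero_mul]
    · rw [hb j i h1, mul_zero]
  · simp

theorem sum_quadratic_string [CharZero F] (y : F) (n : ℕ) :
    ∑ i ∈ Finset.range n, (y - (i : F)) * (y - (i : F) + 1) =
      n * ((y - ((n : F) - 1) / 2) * (y - ((n : F) - 1) / 2 + 1) + ((n : F) ^ 2 - 1) / 12) := by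
  induction n with
  | zero => simp
  | succ n ih => rw [Finset.sum_range_succ, ih]; push_cast; ring

theorem sum_sq_quadratic_string [CharZero F] (y : F) (n : ℕ) :
    ∑ i ∈ Finset.range n, ((y - (i : F)) * (y - (i : F) + 1)) ^ 2 =
      n * (((y - ((n : F) - 1) / 2) * (y - ((n : F) - 1) / 2 + 1)) ^ 2
        + (6 * (y - ((n : F) - 1) / 2) ^ 2 + 6 * (y - ((n : F) - 1) / 2) + 1)
          * (((n : F) ^ 2 - 1) / 12)
        + ((n : F) ^ 2 - 1) * (3 * (n : F) ^ 2 - 7) / 240) := by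
  induction n with
  | zero => simp
  | succ n ih => rw [Finset.sum_range_succ, ih]; push_cast; ring

/-- The third generator `δ - X - Y` also forms a Racah pair with `X`. -/
theorem IsRacahPair.third {X Y : End F V} {δ p q : F} (h : IsRacahPair X Y δ p q) :
    IsRacahPair X (algebraMap F (End F V) δ - X - Y) δ (-p) (q - p) := by
  constructor
  · intro u
    have h1 := h.left u
    simp only [LinearMap.sub_apply, Module.algebraMap_end_apply, map_sub, map_smul]
    linear_combination (norm := module) -h1
  · intro u
    have h1 := h.left u
    have h2 := h.right u
    simp only [LinearMap.sub_apply, Module.algebraMap_end_apply, map_sub, map_smul]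
    linear_combination (norm := module) h2 - h1

theorem IsIrreduciblePair.third {X Y : End F V} (h : IsIrreduciblePair X Y) (δ : F) :
    IsIrreduciblePair X (algebraMap F (End F V) δ - X - Y) := by
  intro W hX hZ
  refine h W hX fun w hw => ?_
  have h1 := sub_mem (sub_mem (W.smul_mem δ hw) (hX w hw)) (hZ w hw)
  simpa using h1

theorem IsRacahPair.trace_relation [CharZero F] [FiniteDimensional F V] {X Y : End F V} {δ p q : F}
    (h : IsRacahPair X Y δ p q) :
    p * finrank F V = δ * LinearMap.trace F V X - LinearMap.trace F V (X * X)
      - 2 * LinearMap.trace F V (X * Y) := by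
  have h1 : X * (X * Y) - (2 : F) • (X * (Y * X)) + Y * (X * X) =
      (2 : F) • (X * Y) + (2 : F) • (Y * X) + (2 : F) • (X * X) - (2 * δ) • X
        + (2 * p) • (1 : End F V) := LinearMap.ext h.left
  have h2 := congrArg (LinearMap.trace F V) h1
  simp only [map_add, map_sub, map_smul, smul_eq_mul, LinearMap.trace_one] at h2
  rw [LinearMap.trace_mul_comm F Y (X * X), LinearMap.trace_mul_comm F Y X,
    ← mul_assoc X Y X, LinearMap.trace_mul_comm F (X * Y) X, mul_assoc X X Y] at h2
  have h3 : (2 : F) ≠ 0 := two_ne_zero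
  apply mul_left_cancel₀ h3
  linear_combination -h2

/-- The inductive step in the computation of the action of `Y` on the basis on which `X` is lower
bidiagonal. -/
theorem IsRacahPair.bidiagonal_step [CharZero F] {X Y : End F V} {a b c D t δ p q : F}
    (h : IsRacahPair X Y δ p q)
    (hδ : δ = D / 2 * (D / 2 + 1) + a * (a + 1) + b * (b + 1) + c * (c + 1))
    (hp : p = (c * (c + 1) - b * (b + 1)) * ((a - D / 2) * (a + D / 2 + 1)))
    {u₀ u₁ u₂ e : V} {f₀ f₁ f₂ : F}
    (h₀ : X u₀ = ((a + D / 2 - t) * (a + D / 2 - t + 1)) • u₀ + u₁)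
    (h₁ : X u₁ = ((a + D / 2 - (t + 1)) * (a + D / 2 - (t + 1) + 1)) • u₁ + u₂)
    (he : X e = ((a + D / 2 - (t - 1)) * (a + D / 2 - (t - 1) + 1)) • e + f₀ • u₀)
    (hY₀ : Y u₀ = ((b + D / 2 - t) * (b + D / 2 - t + 1)) • u₀ + e)
    (hY₁ : Y u₁ = ((b + D / 2 - (t + 1)) * (b + D / 2 - (t + 1) + 1)) • u₁ + f₁ • u₀)
    (hf₀ : f₀ = t * (t - D - 1) * (a + b + c + D / 2 - t + 2) * (a + b - c + D / 2 - t + 1))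
    (hf₁ : f₁ = (t + 1) * ((t + 1) - D - 1) * (a + b + c + D / 2 - (t + 1) + 2) *
      (a + b - c + D / 2 - (t + 1) + 1))
    (hf₂ : f₂ = (t + 2) * ((t + 2) - D - 1) * (a + b + c + D / 2 - (t + 2) + 2) *
      (a + b - c + D / 2 - (t + 2) + 1)) :
    Y u₂ = ((b + D / 2 - (t + 2)) * (b + D / 2 - (t + 2) + 1)) • u₂ + f₂ • u₁ := by
  have h1 := h.left u₀
  simp only [h₀, h₁, he, hY₀, hY₁, map_add, map_smul] at h1
  subst hf₀ hf₁ hf₂ hδ hp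
  linear_combination (norm := module) h1

/-- The vectors `(X - θ_{n-1}) ⋯ (X - θ₀) v`. -/
def bidiagonalVec (X : End F V) (θ : ℕ → F) (v : V) : ℕ → V
  | 0 => v
  | n + 1 => X (bidiagonalVec X θ v n) - θ n • bidiagonalVec X θ v n

theorem apply_bidiagonalVec (X : End F V) (θ : ℕ → F) (v : V) (n : ℕ) :
    X (bidiagonalVec X θ v n) = θ n • bidiagonalVec X θ v n + bidiagonalVec X θ v (n + 1) := by
  simp [bidiagonalVec]

theorem bidiagonalVec_eq_aeval (X : End F V) (θ : ℕ → F) (v : V) (n : ℕ) :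
    bidiagonalVec X θ v n = Polynomial.aeval X
      (∏ i ∈ Finset.range n, (Polynomial.X - Polynomial.C (θ i))) v := by
  induction n with
  | zero => simp [bidiagonalVec]
  | succ n ih =>
    rw [Finset.prod_range_succ, mul_comm, map_mul, Module.End.mul_apply, ← ih]
    simp [bidiagonalVec]

theorem IsHighestWeight.apply_bidiagonalVec [CharZero F] {X Y : End F V}
    {a b c D δ p q κ : F} {v : V}
    (hv : IsHighestWeight X Y δ q (b + D / 2) κ v) (h : IsRacahPair X Y δ p q)
    (hδ : δ = D / 2 * (D / 2 + 1) + a * (a + 1) + b * (b + 1) + c * (c + 1))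
    (hp : p = (c * (c + 1) - b * (b + 1)) * ((a - D / 2) * (a + D / 2 + 1)))
    (hq : q = (c * (c + 1) - a * (a + 1)) * ((b - D / 2) * (b + D / 2 + 1)))
    {θ φ : ℕ → F}
    (hθ : ∀ n : ℕ, θ n = (a + D / 2 - (n : F)) * (a + D / 2 - (n : F) + 1))
    (hφ : ∀ n : ℕ, φ n = (n : F) * ((n : F) - D - 1) * (a + b + c + D / 2 - (n : F) + 2) *
      (a + b - c + D / 2 - (n : F) + 1)) (n : ℕ) :
    Y (bidiagonalVec X θ v (n + 1)) =
      ((b + D / 2 - (n + 1 : ℕ)) * (b + D / 2 - (n + 1 : ℕ) + 1)) • bidiagonalVec X θ v (n + 1)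
        + φ (n + 1) • bidiagonalVec X θ v n := by
  have hX := _root_.apply_bidiagonalVec X θ v
  have h0 : Y (bidiagonalVec X θ v 0) =
      ((b + D / 2 - (0 : ℕ)) * (b + D / 2 - (0 : ℕ) + 1)) • bidiagonalVec X θ v 0 := by
    simpa [bidiagonalVec] using hv.eigen
  have h1 : Y (bidiagonalVec X θ v 1) =
      ((b + D / 2 - (1 : ℕ)) * (b + D / 2 - (1 : ℕ) + 1)) • bidiagonalVec X θ v 1
        + φ 1 • bidiagonalVec X θ v 0 := by
    have hκ : φ 1 = κ - θ 0 * (2 * (b + D / 2)) := by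
      have h2 : -2 * (b + D / 2 + 1) ≠ 0 := mul_ne_zero (by norm_num) hv.weight_ne
      apply mul_right_cancel₀ h2
      rw [sub_mul, hv.coeff, hφ, hθ, hq, hδ]
      push_cast
      ring
    simp only [bidiagonalVec, map_sub, map_smul, hv.raise, hv.eigen, hκ]
    push_cast
    module
  induction n using Nat.twoStepInduction with
  | zero => simpa using h1
  | one =>
    have h2 := h.bidiagonal_step (t := 0) (e := 0) (f₀ := 0) (f₁ := φ 1) (f₂ := φ 2)
      hδ hp (by simpa [hθ] using hX 0) (by simpa [hθ] using hX 1) (by simp)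
      (by simpa using h0) (by simpa using h1) (by simp) (by rw [hφ]; push_cast; ring)
      (by rw [hφ]; push_cast; ring)
    simpa using h2
  | more n ih0 ih1 =>
    have h2 := h.bidiagonal_step (t := ((n + 1 : ℕ) : F)) (f₁ := φ (n + 2)) (f₂ := φ (n + 3))
      (e := φ (n + 1) • bidiagonalVec X θ v n) (f₀ := φ (n + 1))
      (u₀ := bidiagonalVec X θ v (n + 1)) (u₁ := bidiagonalVec X θ v (n + 2))
      (u₂ := bidiagonalVec X θ v (n + 3))
      hδ hp (by rw [hX, hθ]) (by rw [hX, hθ]; push_cast; module)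
      (by rw [map_smul, hX, hθ]; push_cast; module)
      ih0 (by rw [ih1]; push_cast; module) (by rw [hφ]) (by rw [hφ]; push_cast; ring)
      (by rw [hφ]; push_cast; ring)
    rw [h2]; push_cast; module

theorem exists_basis_of_bidiagonal {X Y : End F V} {d : ℕ} {u : ℕ → V} {θ θ' φ : ℕ → F}
    (hirr : IsIrreduciblePair X Y) (hdim : finrank F V = d + 1) (h0 : u 0 ≠ 0)
    (hX : ∀ n, X (u n) = θ n • u n + u (n + 1)) (hY0 : Y (u 0) = θ' 0 • u 0)
    (hY : ∀ n, Y (u (n + 1)) = θ' (n + 1) • u (n + 1) + φ (n + 1) • u n)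
    (hd : u (d + 1) = 0) :
    ∃ b : Basis (Fin (d + 1)) F V, ∀ i, b i = u i := by
  set W := Submodule.span F (Set.range fun i : Fin (d + 1) => u i) with hW
  have hu : ∀ k < d + 1, u k ∈ W := fun k hk => Submodule.subset_span ⟨⟨k, hk⟩, rfl⟩
  have hinv : ∀ T : End F V, (∀ k < d + 1, T (u k) ∈ W) → ∀ w ∈ W, T w ∈ W := by
    intro T hT
    suffices W ≤ W.comap T from this
    refine Submodule.span_le.2 ?_
    rintro _ ⟨i, rfl⟩
    exact hT i i.2
  have htop : W = ⊤ := by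
    refine (hirr W (hinv X fun k hk => ?_) (hinv Y fun k hk => ?_)).resolve_left fun hbot => ?_
    · rw [hX]
      refine add_mem (W.smul_mem _ (hu k hk)) ?_
      rcases Nat.lt_or_ge (k + 1) (d + 1) with h1 | h1
      · exact hu _ h1
      · rw [show k + 1 = d + 1 by omega, hd]; exact W.zero_mem
    · cases k with
      | zero => rw [hY0]; exact W.smul_mem _ (hu 0 hk)
      | succ k =>
        rw [hY]
        exact add_mem (W.smul_mem _ (hu _ hk)) (W.smul_mem _ (hu _ (by omega)))
    · have := hu 0 (by omega)
      rw [hbot, Submodule.mem_bot] at this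
      exact h0 this
  exact ⟨basisOfTopLeSpanOfCardEqFinrank (fun i : Fin (d + 1) => u i) htop.ge (by simp [hdim]),
    fun i => by simp⟩

/-- The spectra of the three generators determine the central parameters. -/
theorem IsRacahPair.exists_parameters [IsAlgClosed F] [CharZero F] [FiniteDimensional F V] {X Y : End F V} {δ p q : F}
    {d : ℕ} (h : IsRacahPair X Y δ p q) (hirr : IsIrreduciblePair X Y)
    (hdim : finrank F V = d + 1) :
    ∃ (a b c κ : F) (v : V), IsHighestWeight X Y δ q (b + (d : F) / 2) κ v ∧
      X.charpoly = ∏ i ∈ Finset.range (d + 1), (Polynomial.X -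
        Polynomial.C ((a + (d : F) / 2 - (i : F)) * (a + (d : F) / 2 - (i : F) + 1))) ∧
      δ = (d : F) / 2 * ((d : F) / 2 + 1) + a * (a + 1) + b * (b + 1) + c * (c + 1) ∧
      p = (c * (c + 1) - b * (b + 1)) * ((a - (d : F) / 2) * (a + (d : F) / 2 + 1)) ∧
      q = (c * (c + 1) - a * (a + 1)) * ((b - (d : F) / 2) * (b + (d : F) / 2 + 1)) := by
  have : Nontrivial V := Module.nontrivial_of_finrank_pos (R := F) (by omega)
  obtain ⟨y, κ, v, hv⟩ := h.exists_highestWeight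
  obtain ⟨x, κx, vx, hx⟩ := h.symm.exists_highestWeight
  obtain ⟨z, κz, vz, hz⟩ := h.third.exists_highestWeight
  have e (s : F) : s - (d : F) / 2 + (d : F) / 2 = s := sub_add_cancel _ _
  refine ⟨x - (d : F) / 2, y - (d : F) / 2, z - (d : F) / 2, κ, v, ?_, ?_, ?_⟩
  · rwa [e]
  · rw [e]; exact hx.charpoly_eq h.symm hirr.symm hdim
  have hN : ((d : F) + 1) ≠ 0 := by exact_mod_cast Nat.succ_ne_zero d
  have tX := hx.trace_eq h.symm hirr.symm hdim
  have tY := hv.trace_eq h hirr hdim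
  have tZ := hz.trace_eq h.third (hirr.third δ) hdim
  have tXX := hx.trace_mul_self_eq h.symm hirr.symm hdim
  have tYY := hv.trace_mul_self_eq h hirr hdim
  have tZZ := hz.trace_mul_self_eq h.third (hirr.third δ) hdim
  have hp := h.trace_relation
  have hq := h.symm.trace_relation
  have hZ1 : LinearMap.trace F V (algebraMap F (End F V) δ - X - Y) =
      δ * ((d : F) + 1) - LinearMap.trace F V X - LinearMap.trace F V Y := by
    rw [Algebra.algebraMap_eq_smul_one, map_sub, map_sub, map_smul, LinearMap.trace_one, hdim]
    simp
  have hZ2 : LinearMap.trace F V ((algebraMap F (End F V) δ - X - Y) *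
        (algebraMap F (End F V) δ - X - Y)) =
      δ ^ 2 * ((d : F) + 1) - 2 * δ * (LinearMap.trace F V X + LinearMap.trace F V Y)
        + LinearMap.trace F V (X * X) + LinearMap.trace F V (Y * Y)
        + 2 * LinearMap.trace F V (X * Y) := by
    have : (algebraMap F (End F V) δ - X - Y) * (algebraMap F (End F V) δ - X - Y) =
        δ ^ 2 • (1 : End F V) - (2 * δ) • (X + Y) + X * X + Y * Y + X * Y + Y * X := by
      ext u
      simp only [LinearMap.sub_apply, LinearMap.add_apply, Module.End.mul_apply,
        LinearMap.smul_apply, Module.algebraMap_end_apply, map_sub, map_smul,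
        Module.End.one_apply]
      module
    rw [this]
    simp only [map_add, map_sub, map_smul, LinearMap.trace_one, hdim, smul_eq_mul,
      LinearMap.trace_mul_comm F Y X]
    push_cast
    ring
  rw [LinearMap.trace_mul_comm F Y X] at hq
  rw [hdim] at hp hq
  rw [sum_quadratic_string] at tX tY tZ
  rw [sum_sq_quadratic_string] at tXX tYY tZZ
  rw [hZ1, tX, tY] at tZ
  rw [hZ2, tX, tY, tXX, tYY] at tZZ
  rw [tX, tXX] at hp
  rw [tY, tYY] at hq
  push_cast at tZ tZZ hp hq
  have hδ : δ = (d : F) / 2 * ((d : F) / 2 + 1) + (x - (d : F) / 2) * (x - (d : F) / 2 + 1)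
      + (y - (d : F) / 2) * (y - (d : F) / 2 + 1)
      + (z - (d : F) / 2) * (z - (d : F) / 2 + 1) := by
    apply mul_right_cancel₀ hN
    linear_combination tZ
  refine ⟨hδ, ?_, ?_⟩
  · apply mul_right_cancel₀ hN
    rw [hδ] at tZZ hp
    linear_combination hp - tZZ
  · apply mul_right_cancel₀ hN
    rw [hδ] at tZZ hq
    linear_combination hq - tZZ

theorem IsRacahPair.exists_bidiagonal_basis [IsAlgClosed F] [CharZero F] {X Y : End F V}
    {δ p q : F} {d : ℕ} (h : IsRacahPair X Y δ p q) (hirr : IsIrreduciblePair X Y)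
    (hdim : finrank F V = d + 1) :
    ∃ (a b c : F) (u : ℕ → V) (w : Basis (Fin (d + 1)) F V),
      (∀ i, w i = u i) ∧ u (d + 1) = 0 ∧
      (∀ n, X (u n) = thP F a d n • u n + u (n + 1)) ∧
      Y (u 0) = thP F b d 0 • u 0 ∧
      (∀ n, Y (u (n + 1)) = thP F b d (n + 1) • u (n + 1) + phP F a b c d (n + 1) • u n) ∧
      δ = (d : F) / 2 * ((d : F) / 2 + 1) + a * (a + 1) + b * (b + 1) + c * (c + 1) := by
  have : FiniteDimensional F V := FiniteDimensional.of_finrank_pos (by omega)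
  obtain ⟨a, b, c, κ, v, hv, hchar, hδ, hp, hq⟩ := h.exists_parameters hirr hdim
  have hX := _root_.apply_bidiagonalVec X (thP F a d) v
  have hY := hv.apply_bidiagonalVec h hδ hp hq (θ := thP F a d) (φ := phP F a b c d)
    (fun _ => rfl) (fun _ => rfl)
  have hY0 : Y (bidiagonalVec X (thP F a d) v 0) =
      thP F b d 0 • bidiagonalVec X (thP F a d) v 0 := by
    simpa [bidiagonalVec, thP] using hv.eigen
  have hd : bidiagonalVec X (thP F a d) v (d + 1) = 0 := by
    rw [bidiagonalVec_eq_aeval]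
    have := LinearMap.aeval_self_charpoly X
    rw [hchar] at this
    simp only [thP, this, LinearMap.zero_apply]
  obtain ⟨w, hw⟩ := exists_basis_of_bidiagonal hirr hdim hv.ne_zero hX hY0 hY hd
  exact ⟨a, b, c, _, w, hw, hd, hX, hY0, hY, hδ⟩

end RacahPair

section RacahModule

variable {F : Type} [Field F]

theorem rA_mul_rB_sub : rA F * rB F - rB F * rA F = 2 * rD F := by
  simpa [rA, rB, rD, two_mul] using RingQuot.mkAlgHom_rel F (RacahRel.AB (F := F))

theorem rB_mul_rC_sub : rB F * rC F - rC F * rB F = 2 * rD F := by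
  simpa [rB, rC, rD, two_mul] using RingQuot.mkAlgHom_rel F (RacahRel.BC (F := F))

theorem rC_mul_rA_sub : rC F * rA F - rA F * rC F = 2 * rD F := by
  simpa [rC, rA, rD, two_mul] using RingQuot.mkAlgHom_rel F (RacahRel.CA (F := F))

theorem rAlpha_eq : rAlpha F = rA F * rD F - rD F * rA F + rA F * rC F - rB F * rA F := by
  simp [rAlpha, alphaFree, rA, rB, rC, rD]

theorem rBeta_eq : rBeta F = rB F * rD F - rD F * rB F + rB F * rA F - rC F * rB F := by
  simp [rBeta, betaFree, rA, rB, rC, rD]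

theorem rAlpha_commute (i : Fin 4) :
    Commute (rAlpha F) (RingQuot.mkAlgHom F (RacahRel F) (ι F i)) := by
  simpa [rAlpha, Commute, SemiconjBy] using RingQuot.mkAlgHom_rel F (RacahRel.alphaC (F := F) i)

theorem rBeta_commute (i : Fin 4) :
    Commute (rBeta F) (RingQuot.mkAlgHom F (RacahRel F) (ι F i)) := by
  simpa [rBeta, Commute, SemiconjBy] using RingQuot.mkAlgHom_rel F (RacahRel.betaC (F := F) i)

theorem rDelta_commute_rA : Commute (rDelta F) (rA F) := by
  unfold rDelta Commute SemiconjBy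
  linear_combination (norm := noncomm_ring) rC_mul_rA_sub (F := F) - rA_mul_rB_sub (F := F)

theorem rDelta_commute_rB : Commute (rDelta F) (rB F) := by
  unfold rDelta Commute SemiconjBy
  linear_combination (norm := noncomm_ring) rA_mul_rB_sub (F := F) - rB_mul_rC_sub (F := F)

@[elab_as_elim]
theorem racahGenerators_induction {P : RacahAlg F → Prop}
    (hs : ∀ r : F, P (algebraMap F _ r))
    (hg : ∀ i : Fin 4, P (RingQuot.mkAlgHom F (RacahRel F) (ι F i)))
    (hmul : ∀ x y, P x → P y → P (x * y)) (hadd : ∀ x y, P x → P y → P (x + y))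
    (x : RacahAlg F) : P x := by
  obtain ⟨x, rfl⟩ := RingQuot.mkAlgHom_surjective F (RacahRel F) x
  induction x using FreeAlgebra.induction with
  | grade0 r => simpa using hs r
  | grade1 i => exact hg i
  | mul x y hx hy => rw [map_mul]; exact hmul _ _ hx hy
  | add x y hx hy => rw [map_add]; exact hadd _ _ hx hy

variable {V : Type} [AddCommGroup V] [Module F V] [Module (RacahAlg F) V]
  [IsScalarTower F (RacahAlg F) V]

theorem eq_bot_or_eq_top_of_racahGenerators (hirr : IsSimpleModule (RacahAlg F) V)
    (W : Submodule F V)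
    (hW : ∀ i : Fin 4, ∀ w ∈ W, RingQuot.mkAlgHom F (RacahRel F) (ι F i) • w ∈ W) :
    W = ⊥ ∨ W = ⊤ := by
  have hinv : ∀ x : RacahAlg F, ∀ w ∈ W, x • w ∈ W := by
    intro x
    induction x using racahGenerators_induction with
    | hs r => intro w hw; rw [algebraMap_smul]; exact W.smul_mem _ hw
    | hg i => exact hW i
    | hmul x y hx hy => intro w hw; rw [mul_smul]; exact hx _ (hy _ hw)
    | hadd x y hx hy => intro w hw; rw [add_smul]; exact add_mem (hx _ hw) (hy _ hw)
  let W' : Submodule (RacahAlg F) V := { W with smul_mem' := fun x w hw => hinv x w hw }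
  have hmem : ∀ w, w ∈ W' ↔ w ∈ W := fun _ => Iff.rfl
  rcases hirr.1.eq_bot_or_eq_top W' with h | h
  · left
    ext w
    rw [← hmem, h, Submodule.mem_bot, Submodule.mem_bot]
  · right
    ext w
    rw [← hmem, h]
    simp

theorem exists_smul_eq_of_commute [IsAlgClosed F] [FiniteDimensional F V]
    (hirr : IsSimpleModule (RacahAlg F) V) {z : RacahAlg F}
    (hz : ∀ i : Fin 4, Commute z (RingQuot.mkAlgHom F (RacahRel F) (ι F i))) :
    ∃ μ : F, ∀ v : V, z • v = μ • v := by
  have : Nontrivial V := IsSimpleModule.nontrivial (RacahAlg F) V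
  obtain ⟨μ, hμ⟩ := Module.End.exists_eigenvalue (Algebra.lsmul F F V z)
  have hmem (v : V) : v ∈ (Algebra.lsmul F F V z).eigenspace μ ↔ z • v = μ • v := by
    rw [Module.End.mem_eigenspace_iff, Algebra.lsmul_coe]
  refine ⟨μ, fun v => (hmem v).1 ?_⟩
  have htop := (eq_bot_or_eq_top_of_racahGenerators hirr
    ((Algebra.lsmul F F V z).eigenspace μ) fun i w hw => ?_).resolve_left hμ
  · rw [htop]; trivial
  · rw [hmem] at hw ⊢
    rw [← mul_smul, hz i, mul_smul, hw, smul_comm]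

theorem exists_isRacahPair [IsAlgClosed F] [CharZero F] [FiniteDimensional F V]
    (hirr : IsSimpleModule (RacahAlg F) V) :
    ∃ δ p q : F, (∀ v : V, rDelta F • v = δ • v) ∧
      IsRacahPair (Algebra.lsmul F F V (rA F)) (Algebra.lsmul F F V (rB F)) δ p q ∧
      IsIrreduciblePair (Algebra.lsmul F F V (rA F)) (Algebra.lsmul F F V (rB F)) := by
  have h2D (v : V) : rD F • v = (2⁻¹ : F) • (rA F • rB F • v - rB F • rA F • v) := by
    rw [← mul_smul, ← mul_smul, ← sub_smul, rA_mul_rB_sub, two_mul, add_smul, ← two_smul F,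
      smul_smul, inv_mul_cancel₀ two_ne_zero, one_smul]
  have hC (v : V) : rC F • v = rDelta F • v - rA F • v - rB F • v := by
    rw [← sub_smul, ← sub_smul]; congr 1; unfold rDelta; abel
  have hdelta : ∀ i : Fin 4, Commute (rDelta F) (RingQuot.mkAlgHom F (RacahRel F) (ι F i)) := by
    have hA := rDelta_commute_rA (F := F)
    have hB := rDelta_commute_rB (F := F)
    have hD : Commute (rDelta F) (rD F) := by
      have h2 : Commute (rDelta F) (2 * rD F) := by
        rw [← rA_mul_rB_sub]
        exact (hA.mul_right hB).sub_right (hB.mul_right hA)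
      have h3 : rD F = (2⁻¹ : F) • (2 * rD F) := by rw [two_mul]; module
      rw [h3]
      exact h2.smul_right _
    have hC' : Commute (rDelta F) (rC F) := by
      have h3 : rC F = rDelta F - rA F - rB F := by unfold rDelta; abel
      rw [h3]
      exact ((Commute.refl _).sub_right hA).sub_right hB
    intro i
    fin_cases i
    · exact hA
    · exact hB
    · exact hC'
    · exact hD
  obtain ⟨δ, hδ⟩ := exists_smul_eq_of_commute (V := V) hirr hdelta
  obtain ⟨p, hp⟩ := exists_smul_eq_of_commute (V := V) hirr rAlpha_commute
  obtain ⟨q, hq⟩ := exists_smul_eq_of_commute (V := V) hirr rBeta_commute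
  have hX (v : V) : rA F • v = Algebra.lsmul F F V (rA F) v := rfl
  have hY (v : V) : rB F • v = Algebra.lsmul F F V (rB F) v := rfl
  refine ⟨δ, p, -q, hδ, ⟨fun u => ?_, fun u => ?_⟩, fun W hA hB => ?_⟩
  · have h1 := hp u
    simp only [rAlpha_eq, sub_smul, add_smul, mul_smul, hC, h2D, hδ, hX, hY] at h1
    generalize Algebra.lsmul F F V (rA F) = X at h1 ⊢
    generalize Algebra.lsmul F F V (rB F) = Y at h1 ⊢
    simp only [map_sub, map_smul] at h1
    linear_combination (norm := module) (2 : F) • h1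
  · have h1 := hq u
    simp only [rBeta_eq, sub_smul, add_smul, mul_smul, hC, h2D, hδ, hX, hY] at h1
    generalize Algebra.lsmul F F V (rA F) = X at h1 ⊢
    generalize Algebra.lsmul F F V (rB F) = Y at h1 ⊢
    simp only [map_sub, map_smul] at h1
    linear_combination (norm := module) (-2 : F) • h1
  · refine eq_bot_or_eq_top_of_racahGenerators hirr W fun i w hw => ?_
    simp only [Algebra.lsmul_coe] at hA hB
    fin_cases i
    · exact hA w hw
    · exact hB w hw
    · change rC F • w ∈ W
      rw [hC, hδ]
      exact sub_mem (sub_mem (W.smul_mem _ hw) (hA w hw)) (hB w hw)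
    · change rD F • w ∈ W
      rw [h2D]
      exact W.smul_mem _ (sub_mem (hA _ (hB w hw)) (hB _ (hA w hw)))

end RacahModule

/-- Every `(d+1)`-dimensional irreducible `ℜ`-module is isomorphic to
`R_d(a,b,c)` for some `a, b, c ∈ F`. -/
theorem stmt6 (F : Type) [Field F] [IsAlgClosed F] [CharZero F] (d : ℕ)
    (V : Type) [AddCommGroup V] [Module (RacahAlg F) V]
    (hdim : letI := resF F (RacahAlg F) V; Module.finrank F V = d + 1)
    (hirr : IsSimpleModule (RacahAlg F) V) :
    ∃ a b c : F, IsRdModule F a b c d V := by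
  let := resF F (RacahAlg F) V
  have := resF_tower F (RacahAlg F) V rfl
  have : FiniteDimensional F V := FiniteDimensional.of_finrank_pos (hdim ▸ Nat.succ_pos d)
  obtain ⟨δ, p, q, hδ, hpair, hpirr⟩ := exists_isRacahPair (F := F) (V := V) hirr
  obtain ⟨a, b, c, u, w, hw, hd, hX, hY0, hY, hδ'⟩ := hpair.exists_bidiagonal_basis hpirr hdim
  simp only [Algebra.lsmul_coe] at hX hY0 hY
  refine ⟨a, b, c, w, fun i => ?_, fun i => ?_, fun v => ?_⟩
  · rw [hw, hX]
    congr 1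
    split_ifs with h
    · rw [hw]
    · rw [show (i : ℕ) + 1 = d + 1 by omega, hd]
  · obtain ⟨i, hi⟩ := i
    cases i with
    | zero => simp [hw, hY0]
    | succ i => simp [hw, hY]
  · rw [hδ, hδ']
end
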